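/- Assume (A3) and (A6), and let (f₋, f₊) be the unique solution of Luckock's equation. For z ∈ Ī define weight functions on I by w^{z,−}₋(x) := λ₋(z)Γ(u₊₋(z) − 1_{{x ≤ z}})(u₋₊(x) − 1_{{x ≤ z}}), w^{z,−}₊(x) := λ₋(z)Γ(u₊₋(max(x,z)) − 1)·u₊₋(min(x,z)), w^{z,+}₋(x) := λ₊(z)Γ(u₋₊(min(x,z)) − 1)·u₋₊(max(x,z)), and w^{z,+}₊(x) := λ₊(z)Γ(u₋₊(z) − 1_{{x ≥ z}})(u₊₋(x) − 1_{{x ≥ z}}). Then the linear functional F^{z,−} associated with (w^{z,−}₋, w^{z,−}₊) satisfies GF^{z,−}(X) = 1_{{M₋(X) ≤ z}} − f₋(z) for every configuration X, and the linear functional F^{z,+} associated with (w^{z,+}₋, w^{z,+}₊) satisfies GF^{z,+}(X) = 1_{{M₊(X) ≥ z}} − f₊(z) for every configuration X. -/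

import Mathlib

open MeasureTheory Set
open scoped ENNReal

noncomputable section

/-- The right limit of `f` at `x`, with the convention `f(b+) := f b` at the
right endpoint `b`. -/
def rLim (b : ℝ) (f : ℝ → ℝ) (x : ℝ) : ℝ :=
  if x < b then Function.rightLim f x else f b

/-- `ν` is the Lebesgue-Stieltjes signed measure `df` of `f` on the interval `[a,b]`,
with the conventions `f(a−) := f a` and `f(b+) := f b`. -/
def IsLS (a b : ℝ) (f : ℝ → ℝ) (ν : MeasureTheory.SignedMeasure ℝ) : Prop :=
  (∀ s : Set ℝ, MeasurableSet s → s ∩ Set.Icc a b = ∅ → ν s = 0) ∧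
  (∀ x y : ℝ, a ≤ x → x ≤ y → y ≤ b → ν (Set.Ioc x y) = rLim b f y - rLim b f x) ∧
  ν {a} = rLim b f a - f a

/-- The integral `∫_s g dν` of `g` over `s` against the signed measure `ν`. -/
def sInt (ν : MeasureTheory.SignedMeasure ℝ) (g : ℝ → ℝ) (s : Set ℝ) : ℝ :=
  (∫ x in s, g x ∂ν.toJordanDecomposition.posPart) -
    ∫ x in s, g x ∂ν.toJordanDecomposition.negPart

/-- Assumption (A3): `lm` (demand) is continuous and nonincreasing, `lp` (supply) is
continuous and nondecreasing on `[a,b]`; both are nonnegative. -/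
def A3 (a b : ℝ) (lm lp : ℝ → ℝ) : Prop :=
  ContinuousOn lm (Set.Icc a b) ∧ ContinuousOn lp (Set.Icc a b) ∧
  AntitoneOn lm (Set.Icc a b) ∧ MonotoneOn lp (Set.Icc a b) ∧
  (∀ x ∈ Set.Icc a b, 0 ≤ lm x) ∧ (∀ x ∈ Set.Icc a b, 0 ≤ lp x)

/-- Assumption (A6): the rates of market orders are positive. -/
def A6 (a b : ℝ) (lm lp : ℝ → ℝ) : Prop := 0 < lp a ∧ 0 < lm b

/-- `(fm, fp)` is a solution of Luckock's equation on `[a,b]` for demand/supply `lm, lp`: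
both are continuous of bounded variation, `fm dlp + lm dfp = 0` and `fp dlm + lp dfm = 0`
as signed measures on `[a,b]`, and `fm b = 1 = fp a`. -/
def LuckockSol (a b : ℝ) (lm lp fm fp : ℝ → ℝ) : Prop :=
  ContinuousOn fm (Set.Icc a b) ∧ ContinuousOn fp (Set.Icc a b) ∧
  BoundedVariationOn fm (Set.Icc a b) ∧ BoundedVariationOn fp (Set.Icc a b) ∧
  fm b = 1 ∧ fp a = 1 ∧
  ∀ νlm νlp νfm νfp : MeasureTheory.SignedMeasure ℝ,
    IsLS a b lm νlm → IsLS a b lp νlp → IsLS a b fm νfm → IsLS a b fp νfp →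
    ∀ s : Set ℝ, MeasurableSet s →
      sInt νlp fm s + sInt νfp lm s = 0 ∧ sInt νlm fp s + sInt νfm lp s = 0

/-- The state of the order book: the multiset of buy limit order prices and the
multiset of sell limit order prices. -/
structure OrderBook where
  minus : Multiset ℝ
  plus : Multiset ℝ

/-- A valid configuration on the interval `(a,b)`: all orders have prices in `(a,b)`
and every buy order is strictly below every sell order. -/
def IsConfig (a b : ℝ) (X : OrderBook) : Prop :=
  (∀ x ∈ X.minus, x ∈ Set.Ioo a b) ∧ (∀ x ∈ X.plus, x ∈ Set.Ioo a b) ∧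
  ∀ x ∈ X.minus, ∀ y ∈ X.plus, x < y

/-- The best (highest) buy offer, `a` if there are no buy limit orders. -/
def Mminus (a : ℝ) (X : OrderBook) : ℝ := sSup (insert a {x | x ∈ X.minus})

/-- The best (lowest) sell offer, `b` if there are no sell limit orders. -/
def Mplus (b : ℝ) (X : OrderBook) : ℝ := sInf (insert b {x | x ∈ X.plus})

open scoped Classical in
/-- The Luckock map for a buy order at price level `u` (`u = b` is a buy market order). -/
def Lminus (a b u : ℝ) (X : OrderBook) : OrderBook :=
  if X.plus ≠ 0 ∧ Mplus b X ≤ u then ⟨X.minus, X.plus.erase (Mplus b X)⟩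
  else if u ∈ Set.Ioo a b then ⟨u ::ₘ X.minus, X.plus⟩ else X

open scoped Classical in
/-- The Luckock map for a sell order at price level `u` (`u = a` is a sell market order). -/
def Lplus (a b u : ℝ) (X : OrderBook) : OrderBook :=
  if X.minus ≠ 0 ∧ u ≤ Mminus a X then ⟨X.minus.erase (Mminus a X), X.plus⟩
  else if u ∈ Set.Ioo a b then ⟨X.minus, u ::ₘ X.plus⟩ else X

/-- The linear functional associated with the weight functions `wm, wp`. -/
def linF (wm wp : ℝ → ℝ) (X : OrderBook) : ℝ :=
  (X.minus.map wm).sum + (X.plus.map wp).sum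

/-- The generator of the Stigler-Luckock model with arrival measures `μm, μp`. -/
def genOp (a b : ℝ) (μm μp : MeasureTheory.Measure ℝ) (F : OrderBook → ℝ)
    (X : OrderBook) : ℝ :=
  (∫ u, (F (Lminus a b u X) - F X) ∂μm) + ∫ u, (F (Lplus a b u X) - F X) ∂μp

/-- `μm` is the arrival measure of buy orders: `μm [x, b] = lm x`, supported on `[a,b]`. -/
def IsMuMinus (a b : ℝ) (lm : ℝ → ℝ) (μm : MeasureTheory.Measure ℝ) : Prop :=
  (∀ x ∈ Set.Icc a b, μm (Set.Icc x b) = ENNReal.ofReal (lm x)) ∧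
  μm (Set.Icc a b)ᶜ = 0

/-- `μp` is the arrival measure of sell orders: `μp [a, x] = lp x`, supported on `[a,b]`. -/
def IsMuPlus (a b : ℝ) (lp : ℝ → ℝ) (μp : MeasureTheory.Measure ℝ) : Prop :=
  (∀ x ∈ Set.Icc a b, μp (Set.Icc a x) = ENNReal.ofReal (lp x)) ∧
  μp (Set.Icc a b)ᶜ = 0

/-- The constant `Γ`, computed from the Lebesgue-Stieltjes measure `νip` of `1/λ₊`. -/
def Gam (a b : ℝ) (lm lp : ℝ → ℝ) (νip : MeasureTheory.SignedMeasure ℝ) : ℝ :=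
  (lm b * lp b)⁻¹ - sInt νip (fun x => (lm x)⁻¹) (Set.Icc a b)

/-- The function `u₋₊`, where `νip` is the Lebesgue-Stieltjes measure of `1/λ₊`. -/
def ump (a b : ℝ) (lm lp : ℝ → ℝ) (νip : MeasureTheory.SignedMeasure ℝ) (x : ℝ) : ℝ :=
  (Gam a b lm lp νip)⁻¹ *
    ((lm b * lp b)⁻¹ - sInt νip (fun t => (lm t)⁻¹) (Set.Ioc x b))

/-- The function `u₊₋`, where `νim` is the Lebesgue-Stieltjes measure of `1/λ₋`. -/
def upm (a b : ℝ) (lm lp : ℝ → ℝ) (νip νim : MeasureTheory.SignedMeasure ℝ) (x : ℝ) : ℝ :=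
  (Gam a b lm lp νip)⁻¹ *
    ((lm a * lp a)⁻¹ + sInt νim (fun t => (lp t)⁻¹) (Set.Ioc a x))

/-- The weight function `w^{z,−}₋`. -/
def wzmm (a b : ℝ) (lm lp : ℝ → ℝ) (νip νim : MeasureTheory.SignedMeasure ℝ)
    (z x : ℝ) : ℝ :=
  lm z * Gam a b lm lp νip *
    (upm a b lm lp νip νim z - if x ≤ z then 1 else 0) *
    (ump a b lm lp νip x - if x ≤ z then 1 else 0)

/-- The weight function `w^{z,−}₊`. -/
def wzmp (a b : ℝ) (lm lp : ℝ → ℝ) (νip νim : MeasureTheory.SignedMeasure ℝ)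
    (z x : ℝ) : ℝ :=
  lm z * Gam a b lm lp νip *
    (upm a b lm lp νip νim (max x z) - 1) * upm a b lm lp νip νim (min x z)

/-- The weight function `w^{z,+}₋`. -/
def wzpm (a b : ℝ) (lm lp : ℝ → ℝ) (νip νim : MeasureTheory.SignedMeasure ℝ)
    (z x : ℝ) : ℝ :=
  lp z * Gam a b lm lp νip *
    (ump a b lm lp νip (min x z) - 1) * ump a b lm lp νip (max x z)

/-- The weight function `w^{z,+}₊`. -/
def wzpp (a b : ℝ) (lm lp : ℝ → ℝ) (νip νim : MeasureTheory.SignedMeasure ℝ)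
    (z x : ℝ) : ℝ :=
  lp z * Gam a b lm lp νip *
    (ump a b lm lp νip z - if z ≤ x then 1 else 0) *
    (upm a b lm lp νip νim x - if z ≤ x then 1 else 0)

open Filter Topology Asymptotics

/-! ### Lebesgue–Stieltjes signed measures of continuous functions -/

lemma rLim_eq_of_continuousOn {a b : ℝ} {f : ℝ → ℝ} (hf : ContinuousOn f (Icc a b)) {x : ℝ}
    (hx : x ∈ Icc a b) : rLim b f x = f x := by
  unfold rLim
  split_ifs with h
  · exact (((hf x hx).mono (Icc_subset_Icc_left hx.1)).mono_of_mem_nhdsWithin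
      (Icc_mem_nhdsGE h)).rightLim_eq
  · rw [le_antisymm hx.2 (not_lt.1 h)]

lemma IsLS.apply_Ioc {a b : ℝ} {f : ℝ → ℝ} {ν : SignedMeasure ℝ} (h : IsLS a b f ν)
    (hf : ContinuousOn f (Icc a b)) {x y : ℝ} (hx : a ≤ x) (hxy : x ≤ y) (hy : y ≤ b) :
    ν (Ioc x y) = f y - f x := by
  rw [h.2.1 x y hx hxy hy, rLim_eq_of_continuousOn hf ⟨hx.trans hxy, hy⟩,
    rLim_eq_of_continuousOn hf ⟨hx, hxy.trans hy⟩]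

lemma IsLS.apply_singleton {a b : ℝ} {f : ℝ → ℝ} {ν : SignedMeasure ℝ} (h : IsLS a b f ν)
    (hf : ContinuousOn f (Icc a b)) (x : ℝ) : ν {x} = 0 := by
  by_cases hx : x ∈ Icc a b
  swap
  · exact h.1 _ (measurableSet_singleton x) (by simpa using hx)
  rcases hx.1.eq_or_lt with rfl | hax
  · rw [h.2.2, rLim_eq_of_continuousOn hf hx, sub_self]
  obtain ⟨u, u_mono, u_mem, u_lim⟩ :
      ∃ u : ℕ → ℝ, StrictMono u ∧ (∀ n : ℕ, u n ∈ Ioo a x) ∧ Tendsto u atTop (𝓝 x) :=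
    exists_seq_strictMono_tendsto' hax
  have A : {x} = ⋂ n, Ioc (u n) x := by
    refine Subset.antisymm (fun y hy => by simp [mem_singleton_iff.1 hy, (u_mem _).2])
      fun y hy => ?_
    replace hy : ∀ i : ℕ, u i < y ∧ y ≤ x := by simpa using hy
    have : x ≤ y := le_of_tendsto' u_lim fun n => (hy n).1.le
    simp [le_antisymm this (hy 0).2]
  have L1 : Tendsto (fun n ↦ ν (Ioc (u n) x)) atTop (𝓝 (ν {x})) := by
    rw [A]
    exact VectorMeasure.tendsto_vectorMeasure_iInter_atTop_nat
      (fun m n hmn ↦ Ioc_subset_Ioc_left (u_mono.monotone hmn)) fun n ↦ measurableSet_Ioc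
  have L2 : Tendsto (fun n ↦ ν (Ioc (u n) x)) atTop (𝓝 (f x - f x)) := by
    have h1 : ∀ n, ν (Ioc (u n) x) = f x - f (u n) := fun n =>
      h.apply_Ioc hf (u_mem n).1.le (u_mem n).2.le hx.2
    simp_rw [h1]
    refine tendsto_const_nhds.sub ((hf x hx).tendsto.comp ?_)
    exact tendsto_nhdsWithin_of_tendsto_nhds_of_eventually_within _ u_lim
      (Eventually.of_forall fun n => ⟨(u_mem n).1.le, (u_mem n).2.le.trans hx.2⟩)
  rw [tendsto_nhds_unique L1 L2, sub_self]

lemma nullSingletonClass_jordan {ν : SignedMeasure ℝ} (h : ∀ x, ν {x} = 0) :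
    NullSingletonClass ν.toJordanDecomposition.posPart ∧
      NullSingletonClass ν.toJordanDecomposition.negPart := by
  obtain ⟨i, hi, hi₂, hi₃, hp, hn⟩ := ν.toJordanDecomposition_spec
  have key : ∀ (s : Set ℝ) (x : ℝ), ν (s ∩ {x}) = 0 := by
    intro s x
    by_cases hx : x ∈ s
    · rw [inter_eq_self_of_subset_right (singleton_subset_iff.2 hx), h]
    · rw [inter_singleton_eq_empty.2 hx, VectorMeasure.empty]
  constructor
  · refine ⟨fun x => ?_⟩
    rw [hp, SignedMeasure.toMeasureOfZeroLE_apply _ _ hi (measurableSet_singleton x)]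
    simp [key]
  · refine ⟨fun x => ?_⟩
    rw [hn, SignedMeasure.toMeasureOfLEZero_apply _ _ hi.compl (measurableSet_singleton x)]
    simp [key]

lemma exists_isLS {a b : ℝ} (hab : a ≤ b) {f : ℝ → ℝ} (hf : ContinuousOn f (Icc a b))
    (hv : BoundedVariationOn f (Icc a b)) : ∃ ν : SignedMeasure ℝ, IsLS a b f ν := by
  set g : ℝ → ℝ := fun x => f (projIcc a b hab x) with hg
  have hgc : Continuous g :=
    (continuousOn_iff_continuous_domRestrict.1 hf).comp continuous_projIcc
  have hgf : ∀ x ∈ Icc a b, g x = f x := fun x hx => by simp [hg, projIcc_of_mem hab hx]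
  have hgv : BoundedVariationOn g univ := by
    refine ne_top_of_le_ne_top hv (eVariationOn.comp_le_of_monotoneOn f
      (fun x => (projIcc a b hab x : ℝ)) ?_ fun x _ => (projIcc a b hab x).2)
    exact fun x _ y _ hxy => monotone_projIcc hab hxy
  refine ⟨hgv.vectorMeasure.restrict (Icc a b), fun s hs hsab => ?_, fun x y hx hxy hy => ?_, ?_⟩
  · rw [VectorMeasure.restrict_apply _ measurableSet_Icc hs, hsab, VectorMeasure.empty]
  · rw [VectorMeasure.restrict_apply _ measurableSet_Icc measurableSet_Ioc,
      inter_eq_self_of_subset_left (Ioc_subset_Icc_self.trans (Icc_subset_Icc hx hy)),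
      hgv.vectorMeasure_Ioc hxy, rLim_eq_of_continuousOn hf ⟨hx.trans hxy, hy⟩,
      rLim_eq_of_continuousOn hf ⟨hx, hxy.trans hy⟩, hgc.continuousWithinAt.rightLim_eq,
      hgc.continuousWithinAt.rightLim_eq, hgf y ⟨hx.trans hxy, hy⟩, hgf x ⟨hx, hxy.trans hy⟩]
  · rw [VectorMeasure.restrict_apply _ measurableSet_Icc (measurableSet_singleton a),
      inter_eq_self_of_subset_left (singleton_subset_iff.2 (left_mem_Icc.2 hab)),
      hgv.vectorMeasure_singleton, rLim_eq_of_continuousOn hf (left_mem_Icc.2 hab),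
      hgc.continuousWithinAt.rightLim_eq, hgc.continuousWithinAt.leftLim_eq, sub_self, sub_self]

lemma sInt_Ioc_sub {a b : ℝ} (ν : SignedMeasure ℝ) {g : ℝ → ℝ} (hg : ContinuousOn g (Icc a b))
    {x y : ℝ} (hx : a ≤ x) (hxy : x ≤ y) (hy : y ≤ b) :
    sInt ν g (Ioc a y) - sInt ν g (Ioc a x) = sInt ν g (Ioc x y) := by
  have key : ∀ ρ : Measure ℝ, IsFiniteMeasure ρ →
      ∫ t in Ioc a y, g t ∂ρ = ∫ t in Ioc a x, g t ∂ρ + ∫ t in Ioc x y, g t ∂ρ := by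
    intro ρ _
    have hi : IntegrableOn g (Icc a b) ρ := hg.integrableOn_Icc
    rw [← setIntegral_union (Ioc_disjoint_Ioc_of_le le_rfl) measurableSet_Ioc
      (hi.mono_set (Ioc_subset_Icc_self.trans (Icc_subset_Icc_right (hxy.trans hy))))
      (hi.mono_set (Ioc_subset_Icc_self.trans (Icc_subset_Icc hx hy))),
      Ioc_union_Ioc_eq_Ioc hx hxy]
  simp only [sInt]
  rw [key _ inferInstance, key ν.toJordanDecomposition.negPart inferInstance]
  ring

lemma sInt_Icc_eq {ν : SignedMeasure ℝ} (h : ∀ x, ν {x} = 0) (g : ℝ → ℝ) (a b : ℝ) :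
    sInt ν g (Icc a b) = sInt ν g (Ioc a b) := by
  obtain ⟨h1, h2⟩ := nullSingletonClass_jordan h
  simp only [sInt, integral_Icc_eq_integral_Ioc]

lemma continuousOn_sInt {a b : ℝ} {ν : SignedMeasure ℝ} (h : ∀ x, ν {x} = 0) {g : ℝ → ℝ}
    (hg : ContinuousOn g (Icc a b)) :
    ContinuousOn (fun x => sInt ν g (Ioc a x)) (Icc a b) := by
  obtain ⟨h1, h2⟩ := nullSingletonClass_jordan h
  exact (intervalIntegral.continuousOn_primitive hg.integrableOn_Icc).sub
    (intervalIntegral.continuousOn_primitive hg.integrableOn_Icc)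

/-! ### Infinitesimal increments relative to a finite measure -/

lemma tendsto_measureReal_Ioc (σ : Measure ℝ) [IsFiniteMeasure σ] (x : ℝ) :
    Tendsto (fun y => σ.real (Ioc x y)) (𝓝[>] x) (𝓝 0) := by
  have h := tendsto_measure_biInter_gt (μ := σ) (s := fun y => Ioc x y) (a := x)
    (fun r _ => measurableSet_Ioc.nullMeasurableSet)
    (fun i j _ hij => Ioc_subset_Ioc_right hij) ⟨x + 1, by simp, measure_ne_top _ _⟩
  have h0 : (⋂ r > x, Ioc x r) = ∅ := by
    refine eq_empty_of_forall_notMem fun y hy => ?_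
    simp only [mem_iInter, mem_Ioc] at hy
    have h1 := (hy (x + 1) (by simp)).1
    have h2 := (hy ((x + y) / 2) (by simp only [gt_iff_lt]; linarith)).2
    linarith
  rw [h0, measure_empty] at h
  simpa [Measure.real, Function.comp_def] using
    (ENNReal.tendsto_toReal ENNReal.zero_ne_top).comp h

lemma eq_of_increments_isLittleO (σ : Measure ℝ) [IsFiniteMeasure σ] [NullSingletonClass σ]
    {x₀ y₀ : ℝ} (h : x₀ ≤ y₀) {H : ℝ → ℝ} (hc : ContinuousOn H (Icc x₀ y₀))
    (hd : ∀ x ∈ Ico x₀ y₀, (fun y => H y - H x) =o[𝓝[>] x] fun y => σ.real (Ioc x y)) :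
    H y₀ = H x₀ := by
  have hσc : ContinuousOn (fun t => σ.real (Ioc x₀ t)) (Icc x₀ y₀) := by
    have := intervalIntegral.continuousOn_primitive (μ := σ) (f := fun _ => (1 : ℝ))
      (a := x₀) (b := y₀) (integrableOn_const (measure_ne_top _ _))
    simpa using this
  have key : ∀ ε > 0, |H y₀ - H x₀| ≤ ε * σ.real (Ioc x₀ y₀) := by
    intro ε hε
    have hsub : Icc x₀ y₀ ⊆ {t | |H t - H x₀| ≤ ε * σ.real (Ioc x₀ t)} := by
      refine IsClosed.Icc_subset_of_forall_mem_nhdsWithin ?_ (by simp) ?_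
      · have : IsClosed (Icc x₀ y₀ ∩
            {t | |H t - H x₀| ≤ ε * σ.real (Ioc x₀ t)}) :=
          isClosed_Icc.isClosed_le (hc.sub continuousOn_const).abs (hσc.const_smul ε)
        rwa [inter_comm] at this
      · rintro x ⟨hx, hxI⟩
        have h1 := (isLittleO_iff.1 (hd x hxI)) hε
        filter_upwards [h1, self_mem_nhdsWithin] with y hy hxy
        simp only [mem_ofPred_eq] at hx ⊢
        rw [Real.norm_eq_abs, Real.norm_of_nonneg measureReal_nonneg] at hy
        have h2 : σ.real (Ioc x₀ y) = σ.real (Ioc x₀ x) + σ.real (Ioc x y) := by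
          rw [← measureReal_union (Ioc_disjoint_Ioc_of_le le_rfl) measurableSet_Ioc,
            Ioc_union_Ioc_eq_Ioc hxI.1 (le_of_lt hxy)]
        have h3 := abs_sub_le (H y) (H x) (H x₀)
        rw [h2, mul_add]
        linarith
    exact hsub (right_mem_Icc.2 h)
  by_contra hne
  have hpos : 0 < |H y₀ - H x₀| := abs_pos.2 (sub_ne_zero.2 hne)
  have hm : 0 ≤ σ.real (Ioc x₀ y₀) := measureReal_nonneg
  have := key (|H y₀ - H x₀| / (σ.real (Ioc x₀ y₀) + 1)) (by positivity)
  rw [div_mul_eq_mul_div, le_div_iff₀ (by positivity)] at this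
  nlinarith

lemma setIntegral_Ioc_isLittleO (σ : Measure ℝ) [IsFiniteMeasure σ] {ρ : Measure ℝ} (hρ : ρ ≤ σ)
    {g : ℝ → ℝ} {x c L : ℝ} (hxc : x < c) (hi : IntegrableOn g (Ioc x c) ρ)
    (hL : Tendsto g (𝓝[>] x) (𝓝 L)) :
    (fun y => ∫ t in Ioc x y, g t ∂ρ - L * ρ.real (Ioc x y)) =o[𝓝[>] x]
      fun y => σ.real (Ioc x y) := by
  have : IsFiniteMeasure ρ := isFiniteMeasure_of_le σ hρ
  refine isLittleO_iff.2 fun ε hε => ?_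
  have h1 : ∀ᶠ t in 𝓝[>] x, dist (g t) L < ε := hL (Metric.ball_mem_nhds L hε)
  obtain ⟨d, hd, hd'⟩ := mem_nhdsGT_iff_exists_Ioo_subset.1 h1
  have hdc : x < min d c := lt_min hd hxc
  filter_upwards [Ioo_mem_nhdsGT hdc] with y hy
  have hy1 : y < d := hy.2.trans_le (min_le_left _ _)
  have hy2 : y < c := hy.2.trans_le (min_le_right _ _)
  have h2 : ∫ t in Ioc x y, g t ∂ρ - L * ρ.real (Ioc x y) = ∫ t in Ioc x y, (g t - L) ∂ρ := by
    rw [integral_sub (hi.mono_set (Ioc_subset_Ioc_right hy2.le))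
      (integrableOn_const (measure_ne_top _ _)), setIntegral_const, smul_eq_mul, mul_comm]
  rw [h2, Real.norm_of_nonneg (measureReal_nonneg (μ := σ))]
  refine (norm_setIntegral_le_of_norm_le_const (measure_lt_top _ _) (C := ε) fun t ht => ?_).trans
    ?_
  · exact le_of_lt (hd' ⟨ht.1, ht.2.trans_lt hy1⟩)
  · exact mul_le_mul_of_nonneg_left
      (ENNReal.toReal_mono (measure_ne_top _ _) (hρ _)) hε.le

lemma sInt_Ioc_isLittleO (σ : Measure ℝ) [IsFiniteMeasure σ] {ν : SignedMeasure ℝ}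
    (hp : ν.toJordanDecomposition.posPart ≤ σ) (hn : ν.toJordanDecomposition.negPart ≤ σ)
    {a b : ℝ} {g : ℝ → ℝ} (hg : ContinuousOn g (Icc a b)) {x : ℝ} (hx : x ∈ Ico a b) :
    (fun y => sInt ν g (Ioc x y) - g x * ν (Ioc x y)) =o[𝓝[>] x] fun y => σ.real (Ioc x y) := by
  have hL : Tendsto g (𝓝[>] x) (𝓝 (g x)) :=
    ((hg x (Ico_subset_Icc_self hx)).mono_of_mem_nhdsWithin
      (mem_of_superset (Ioc_mem_nhdsGT hx.2) fun y hy => ⟨hx.1.trans hy.1.le, hy.2⟩) :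
      ContinuousWithinAt g (Ioi x) x)
  have hi : ∀ ρ : Measure ℝ, IsFiniteMeasure ρ → IntegrableOn g (Ioc x b) ρ := fun ρ _ =>
    hg.integrableOn_Icc.mono_set (Ioc_subset_Icc_self.trans (Icc_subset_Icc_left hx.1))
  refine ((setIntegral_Ioc_isLittleO σ hp hx.2 (hi _ inferInstance) hL).sub
    (setIntegral_Ioc_isLittleO σ hn hx.2 (hi _ inferInstance) hL)).congr_left fun y => ?_
  rw [SignedMeasure.apply_eq_posPart_real_sub_negPart_real ν measurableSet_Ioc, sInt]
  ring

/-- `F` has right differential `p dA + q dB` at `x`, up to an error that is negligible with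
respect to `σ`. -/
def HasRightDiff (σ : Measure ℝ) (A B F : ℝ → ℝ) (p q x : ℝ) : Prop :=
  (fun y => F y - F x - (p * (A y - A x) + q * (B y - B x))) =o[𝓝[>] x]
    fun y => σ.real (Ioc x y)

namespace HasRightDiff

variable {σ : Measure ℝ} {A B F G : ℝ → ℝ} {p q p' q' x : ℝ}

lemma isBigO (hA : (fun y => A y - A x) =O[𝓝[>] x] fun y => σ.real (Ioc x y))
    (hB : (fun y => B y - B x) =O[𝓝[>] x] fun y => σ.real (Ioc x y))
    (hF : HasRightDiff σ A B F p q x) :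
    (fun y => F y - F x) =O[𝓝[>] x] fun y => σ.real (Ioc x y) :=
  (((show (_ : ℝ → ℝ) =o[𝓝[>] x] _ from hF).isBigO).add
    ((hA.const_mul_left p).add (hB.const_mul_left q))).congr_left
    fun y => by ring

lemma tendsto [IsFiniteMeasure σ]
    (hA : (fun y => A y - A x) =O[𝓝[>] x] fun y => σ.real (Ioc x y))
    (hB : (fun y => B y - B x) =O[𝓝[>] x] fun y => σ.real (Ioc x y))
    (hF : HasRightDiff σ A B F p q x) : Tendsto F (𝓝[>] x) (𝓝 (F x)) := by
  have h := ((hF.isBigO hA hB).trans_tendsto (tendsto_measureReal_Ioc σ x)).add_const (F x)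
  simpa using h

lemma const (k : ℝ) : HasRightDiff σ A B (fun _ => k) 0 0 x := by
  simp [HasRightDiff]

lemma fst : HasRightDiff σ A B A 1 0 x := by
  simp [HasRightDiff]

lemma snd : HasRightDiff σ A B B 0 1 x := by
  simp [HasRightDiff]

lemma add (hF : HasRightDiff σ A B F p q x) (hG : HasRightDiff σ A B G p' q' x) :
    HasRightDiff σ A B (fun y => F y + G y) (p + p') (q + q') x :=
  (IsLittleO.add hF hG).congr_left fun y => by ring

lemma sub (hF : HasRightDiff σ A B F p q x) (hG : HasRightDiff σ A B G p' q' x) :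
    HasRightDiff σ A B (fun y => F y - G y) (p - p') (q - q') x :=
  (IsLittleO.sub hF hG).congr_left fun y => by ring

lemma const_mul (k : ℝ) (hF : HasRightDiff σ A B F p q x) :
    HasRightDiff σ A B (fun y => k * F y) (k * p) (k * q) x :=
  (IsLittleO.const_mul_left hF k).congr_left fun y => by ring

lemma mul [IsFiniteMeasure σ]
    (hA : (fun y => A y - A x) =O[𝓝[>] x] fun y => σ.real (Ioc x y))
    (hB : (fun y => B y - B x) =O[𝓝[>] x] fun y => σ.real (Ioc x y))
    (hF : HasRightDiff σ A B F p q x) (hG : HasRightDiff σ A B G p' q' x) :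
    HasRightDiff σ A B (fun y => F y * G y) (F x * p' + G x * p) (F x * q' + G x * q) x := by
  have h1 : (fun y => F y - F x) =o[𝓝[>] x] fun _ => (1 : ℝ) := by
    rw [isLittleO_one_iff]
    exact (hF.isBigO hA hB).trans_tendsto (tendsto_measureReal_Ioc σ x)
  have h2 := h1.mul_isBigO (hG.isBigO hA hB)
  simp only [one_mul] at h2
  exact (((IsLittleO.const_mul_left hG (F x)).add (IsLittleO.const_mul_left hF (G x))).add
    h2).congr_left fun y => by ring

lemma inv [IsFiniteMeasure σ]
    (hA : (fun y => A y - A x) =O[𝓝[>] x] fun y => σ.real (Ioc x y))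
    (hB : (fun y => B y - B x) =O[𝓝[>] x] fun y => σ.real (Ioc x y))
    (hF : HasRightDiff σ A B F p q x) (h0 : F x ≠ 0) :
    HasRightDiff σ A B (fun y => (F y)⁻¹) (-(p / F x ^ 2)) (-(q / F x ^ 2)) x := by
  have h1 := (hasDerivAt_inv h0).isLittleO.comp_tendsto (hF.tendsto hA hB)
  have h2 := h1.trans_isBigO (hF.isBigO hA hB)
  refine (h2.add (IsLittleO.const_mul_left hF (-(F x ^ 2)⁻¹))).congr_left fun y => ?_
  simp only [Function.comp_apply, smul_eq_mul]
  ring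

lemma congr_coeff (hF : HasRightDiff σ A B F p q x) (hp : p = p') (hq : q = q') :
    HasRightDiff σ A B F p' q' x := by
  rwa [← hp, ← hq]

end HasRightDiff

lemma eq_of_hasRightDiff_zero (σ : Measure ℝ) [IsFiniteMeasure σ] [NullSingletonClass σ]
    {A B H : ℝ → ℝ} {x₀ y₀ : ℝ} (h : x₀ ≤ y₀) (hc : ContinuousOn H (Icc x₀ y₀))
    (hd : ∀ x ∈ Ico x₀ y₀, HasRightDiff σ A B H 0 0 x) : H y₀ = H x₀ :=
  eq_of_increments_isLittleO σ h hc fun x hx =>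
    (show HasRightDiff σ A B H 0 0 x from hd x hx).congr_left fun y => by ring

lemma hasRightDiff_sInt {σ : Measure ℝ} [IsFiniteMeasure σ] {ν : SignedMeasure ℝ}
    (hp : ν.toJordanDecomposition.posPart ≤ σ) (hn : ν.toJordanDecomposition.negPart ≤ σ)
    {a b x p q : ℝ} {A B f g : ℝ → ℝ} (hν : IsLS a b f ν) (hf : ContinuousOn f (Icc a b))
    (hg : ContinuousOn g (Icc a b)) (hx : x ∈ Ico a b) (hd : HasRightDiff σ A B f p q x) :
    HasRightDiff σ A B (fun y => sInt ν g (Ioc a y)) (g x * p) (g x * q) x := by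
  refine ((sInt_Ioc_isLittleO σ hp hn hg hx).add
    (IsLittleO.const_mul_left hd (g x))).congr' ?_ EventuallyEq.rfl
  filter_upwards [Ioc_mem_nhdsGT hx.2] with y hy
  rw [sInt_Ioc_sub ν hg hx.1 hy.1.le hy.2, hν.apply_Ioc hf hx.1 hy.1.le hy.2]
  ring

lemma hasRightDiff_setIntegral {σ : Measure ℝ} [IsFiniteMeasure σ] {ρ : Measure ℝ} (hρ : ρ ≤ σ)
    {a b x p q : ℝ} {A B f g : ℝ → ℝ}
    (hf : ∀ x y, a ≤ x → x ≤ y → y ≤ b → ρ.real (Ioc x y) = f y - f x)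
    (hg : ContinuousOn g (Icc a b)) (hx : x ∈ Ico a b) {c : ℝ} (hac : a ≤ c) (hcx : c ≤ x)
    (hd : HasRightDiff σ A B f p q x) :
    HasRightDiff σ A B (fun y => ∫ t in Ioc c y, g t ∂ρ) (g x * p) (g x * q) x := by
  have : IsFiniteMeasure ρ := isFiniteMeasure_of_le σ hρ
  have hL : Tendsto g (𝓝[>] x) (𝓝 (g x)) :=
    ((hg x (Ico_subset_Icc_self hx)).mono_of_mem_nhdsWithin
      (mem_of_superset (Ioc_mem_nhdsGT hx.2) fun y hy => ⟨hx.1.trans hy.1.le, hy.2⟩) :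
      ContinuousWithinAt g (Ioi x) x)
  have hi : IntegrableOn g (Icc a b) ρ := hg.integrableOn_Icc
  refine ((setIntegral_Ioc_isLittleO σ hρ hx.2
    (hi.mono_set (Ioc_subset_Icc_self.trans (Icc_subset_Icc_left hx.1))) hL).add
    (IsLittleO.const_mul_left hd (g x))).congr' ?_ EventuallyEq.rfl
  filter_upwards [Ioc_mem_nhdsGT hx.2] with y hy
  rw [← Ioc_union_Ioc_eq_Ioc hcx hy.1.le,
    setIntegral_union (Ioc_disjoint_Ioc_of_le le_rfl) measurableSet_Ioc
      (hi.mono_set (Ioc_subset_Icc_self.trans (Icc_subset_Icc hac hx.2.le)))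
      (hi.mono_set (Ioc_subset_Icc_self.trans (Icc_subset_Icc hx.1 hy.2))),
    hf x y hx.1 hy.1.le hy.2]
  ring

lemma sub_isBigO_of_measureReal {σ ρ : Measure ℝ} [IsFiniteMeasure σ] (hρ : ρ ≤ σ)
    {a b x : ℝ} {f : ℝ → ℝ}
    (hf : ∀ x y, a ≤ x → x ≤ y → y ≤ b → ρ.real (Ioc x y) = f y - f x) (hx : x ∈ Ico a b) :
    (fun y => f y - f x) =O[𝓝[>] x] fun y => σ.real (Ioc x y) := by
  refine IsBigO.of_bound 1 ?_
  filter_upwards [Ioc_mem_nhdsGT hx.2] with y hy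
  rw [← hf x y hx.1 hy.1.le hy.2, Real.norm_of_nonneg measureReal_nonneg,
    Real.norm_of_nonneg measureReal_nonneg, one_mul]
  exact ENNReal.toReal_mono (measure_ne_top _ _) (hρ _)

lemma hasRightDiff_of_sInt_add_eq_zero {σ : Measure ℝ} [IsFiniteMeasure σ]
    {ν₁ ν₂ : SignedMeasure ℝ}
    (hp₁ : ν₁.toJordanDecomposition.posPart ≤ σ) (hn₁ : ν₁.toJordanDecomposition.negPart ≤ σ)
    (hp₂ : ν₂.toJordanDecomposition.posPart ≤ σ) (hn₂ : ν₂.toJordanDecomposition.negPart ≤ σ)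
    {a b x p q : ℝ} {A B f₁ f₂ g₁ g₂ : ℝ → ℝ} (hν₁ : IsLS a b f₁ ν₁) (hν₂ : IsLS a b f₂ ν₂)
    (hf₁ : ContinuousOn f₁ (Icc a b)) (hf₂ : ContinuousOn f₂ (Icc a b))
    (hg₁ : ContinuousOn g₁ (Icc a b)) (hg₂ : ContinuousOn g₂ (Icc a b)) (hx : x ∈ Ico a b)
    (h : ∀ s, MeasurableSet s → sInt ν₁ g₁ s + sInt ν₂ g₂ s = 0) (h0 : g₂ x ≠ 0)
    (hd : HasRightDiff σ A B f₁ p q x) :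
    HasRightDiff σ A B f₂ (-(g₁ x / g₂ x) * p) (-(g₁ x / g₂ x) * q) x := by
  have h1 := (((sInt_Ioc_isLittleO σ hp₁ hn₁ hg₁ hx).add
    (sInt_Ioc_isLittleO σ hp₂ hn₂ hg₂ hx)).const_mul_left (-(g₂ x)⁻¹)).sub
    (IsLittleO.const_mul_left hd (g₁ x / g₂ x))
  refine h1.congr' ?_ EventuallyEq.rfl
  filter_upwards [Ioc_mem_nhdsGT hx.2] with y hy
  have h2 : sInt ν₁ g₁ (Ioc x y) = -sInt ν₂ g₂ (Ioc x y) :=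
    eq_neg_of_add_eq_zero_left (h _ measurableSet_Ioc)
  rw [h2, hν₁.apply_Ioc hf₁ hx.1 hy.1.le hy.2, hν₂.apply_Ioc hf₂ hx.1 hy.1.le hy.2]
  field_simp
  ring

/-! ### The arrival measures -/

section ArrivalMeasures

variable {a b : ℝ} {lm lp : ℝ → ℝ} {μm μp : Measure ℝ}

lemma IsMuMinus.isFiniteMeasure (h : IsMuMinus a b lm μm) (hab : a ≤ b) : IsFiniteMeasure μm := by
  refine ⟨?_⟩
  rw [← union_compl_self (Icc a b)]
  refine (measure_union_le _ _).trans_lt ?_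
  rw [h.1 a (left_mem_Icc.2 hab), h.2, add_zero]
  exact ENNReal.ofReal_lt_top

lemma IsMuPlus.isFiniteMeasure (h : IsMuPlus a b lp μp) (hab : a ≤ b) : IsFiniteMeasure μp := by
  refine ⟨?_⟩
  rw [← union_compl_self (Icc a b)]
  refine (measure_union_le _ _).trans_lt ?_
  rw [h.1 b (right_mem_Icc.2 hab), h.2, add_zero]
  exact ENNReal.ofReal_lt_top

lemma IsMuMinus.real_Icc (h : IsMuMinus a b lm μm) (h0 : ∀ x ∈ Icc a b, 0 ≤ lm x) {x : ℝ}
    (hx : x ∈ Icc a b) : μm.real (Icc x b) = lm x := by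
  rw [Measure.real, h.1 x hx, ENNReal.toReal_ofReal (h0 x hx)]

lemma IsMuPlus.real_Icc (h : IsMuPlus a b lp μp) (h0 : ∀ x ∈ Icc a b, 0 ≤ lp x) {x : ℝ}
    (hx : x ∈ Icc a b) : μp.real (Icc a x) = lp x := by
  rw [Measure.real, h.1 x hx, ENNReal.toReal_ofReal (h0 x hx)]

lemma IsMuMinus.real_Ico (h : IsMuMinus a b lm μm) (h0 : ∀ x ∈ Icc a b, 0 ≤ lm x) {x y : ℝ}
    (hx : a ≤ x) (hxy : x ≤ y) (hy : y ≤ b) : μm.real (Ico x y) = lm x - lm y := by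
  have := h.isFiniteMeasure (hx.trans (hxy.trans hy))
  have h1 : Ico x y = Icc x b \ Icc y b := by
    ext t
    simp only [mem_Ico, Set.mem_sdiff, mem_Icc, not_and, not_le]
    constructor
    · exact fun ht => ⟨⟨ht.1, ht.2.le.trans hy⟩, fun h => absurd ht.2 (not_lt.2 h)⟩
    · exact fun ht => ⟨ht.1.1, not_le.1 fun h => absurd (ht.2 h) (not_lt.2 ht.1.2)⟩
  rw [h1, measureReal_sdiff (Icc_subset_Icc_left hxy) measurableSet_Icc,
    h.real_Icc h0 ⟨hx, hxy.trans hy⟩, h.real_Icc h0 ⟨hx.trans hxy, hy⟩]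

lemma IsMuPlus.real_Ioc (h : IsMuPlus a b lp μp) (h0 : ∀ x ∈ Icc a b, 0 ≤ lp x) {x y : ℝ}
    (hx : a ≤ x) (hxy : x ≤ y) (hy : y ≤ b) : μp.real (Ioc x y) = lp y - lp x := by
  have := h.isFiniteMeasure (hx.trans (hxy.trans hy))
  have h1 : Ioc x y = Icc a y \ Icc a x := by
    ext t
    simp only [mem_Ioc, Set.mem_sdiff, mem_Icc, not_and, not_le]
    constructor
    · exact fun ht => ⟨⟨hx.trans ht.1.le, ht.2⟩, fun _ => ht.1⟩
    · exact fun ht => ⟨ht.2 ht.1.1, ht.1.2⟩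
  rw [h1, measureReal_sdiff (Icc_subset_Icc_right hxy) measurableSet_Icc,
    h.real_Icc h0 ⟨hx.trans hxy, hy⟩, h.real_Icc h0 ⟨hx, hxy.trans hy⟩]

lemma IsMuMinus.singleton (h : IsMuMinus a b lm μm) (h0 : ∀ x ∈ Icc a b, 0 ≤ lm x)
    (hc : ContinuousOn lm (Icc a b)) {x : ℝ} (hx : x ∈ Ico a b) : μm {x} = 0 := by
  have := h.isFiniteMeasure (hx.1.trans hx.2.le)
  have h1 : Tendsto (fun y => lm x - lm y) (𝓝[>] x) (𝓝 (lm x - lm x)) :=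
    tendsto_const_nhds.sub ((hc x (Ico_subset_Icc_self hx)).mono_of_mem_nhdsWithin
      (mem_of_superset (Ioc_mem_nhdsGT hx.2) fun y hy => ⟨hx.1.trans hy.1.le, hy.2⟩) :
      ContinuousWithinAt lm (Ioi x) x)
  have h2 : μm.real {x} ≤ lm x - lm x := by
    refine ge_of_tendsto h1 ?_
    filter_upwards [Ioc_mem_nhdsGT hx.2] with y hy
    rw [← h.real_Ico h0 hx.1 hy.1.le hy.2]
    exact measureReal_mono (singleton_subset_iff.2 ⟨le_rfl, hy.1⟩)
  rw [sub_self] at h2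
  exact (measureReal_eq_zero_iff).1 (le_antisymm h2 measureReal_nonneg)

lemma IsMuPlus.singleton (h : IsMuPlus a b lp μp) (h0 : ∀ x ∈ Icc a b, 0 ≤ lp x)
    (hc : ContinuousOn lp (Icc a b)) {x : ℝ} (hx : x ∈ Ioc a b) : μp {x} = 0 := by
  have := h.isFiniteMeasure (hx.1.le.trans hx.2)
  have h1 : Tendsto (fun y => lp x - lp y) (𝓝[<] x) (𝓝 (lp x - lp x)) :=
    tendsto_const_nhds.sub ((hc x (Ioc_subset_Icc_self hx)).mono_of_mem_nhdsWithin
      (mem_of_superset (Ico_mem_nhdsLT hx.1) fun y hy => ⟨hy.1, hy.2.le.trans hx.2⟩) :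
      ContinuousWithinAt lp (Iio x) x)
  have h2 : μp.real {x} ≤ lp x - lp x := by
    refine ge_of_tendsto h1 ?_
    filter_upwards [Ico_mem_nhdsLT hx.1] with y hy
    rw [← h.real_Ioc h0 hy.1 hy.2.le hx.2]
    exact measureReal_mono (singleton_subset_iff.2 ⟨hy.2, le_rfl⟩)
  rw [sub_self] at h2
  exact (measureReal_eq_zero_iff).1 (le_antisymm h2 measureReal_nonneg)

lemma nullSingletonClass_restrict {μ : Measure ℝ} {s : Set ℝ} (h : ∀ x ∈ s, μ {x} = 0) :
    NullSingletonClass (μ.restrict s) := by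
  refine ⟨fun x => ?_⟩
  rw [Measure.restrict_apply (measurableSet_singleton x)]
  by_cases hx : x ∈ s
  · exact measure_mono_null inter_subset_left (h x hx)
  · rw [singleton_inter_eq_empty.2 hx, measure_empty]

lemma IsMuMinus.restrict_real_Ioc (h : IsMuMinus a b lm μm) (h0 : ∀ x ∈ Icc a b, 0 ≤ lm x)
    (hc : ContinuousOn lm (Icc a b)) (hab : a < b) {x y : ℝ} (hx : a ≤ x) (hxy : x ≤ y)
    (hy : y ≤ b) : (μm.restrict (Ioo a b)).real (Ioc x y) = lm x - lm y := by
  have := nullSingletonClass_restrict (μ := μm) (s := Ioo a b)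
    fun t ht => h.singleton h0 hc (Ioo_subset_Ico_self ht)
  have h1 : Ico x y ∩ Ioo a b = Ico x y \ {a} := by
    ext t
    simp only [mem_inter_iff, mem_Ico, mem_Ioo, Set.mem_sdiff, mem_singleton_iff]
    constructor
    · exact fun ht => ⟨ht.1, ht.2.1.ne'⟩
    · exact fun ht => ⟨ht.1, (hx.trans ht.1.1).lt_of_ne' ht.2, ht.1.2.trans_le hy⟩
  rw [← h.real_Ico h0 hx hxy hy, ← measureReal_congr (Ico_ae_eq_Ioc (a := x) (b := y)),
    measureReal_restrict_apply measurableSet_Ico, h1, Measure.real,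
    measure_sdiff_null (h.singleton h0 hc ⟨le_rfl, hab⟩), Measure.real]

lemma IsMuPlus.restrict_real_Ioc (h : IsMuPlus a b lp μp) (h0 : ∀ x ∈ Icc a b, 0 ≤ lp x)
    (hc : ContinuousOn lp (Icc a b)) (hab : a < b) {x y : ℝ} (hx : a ≤ x) (hxy : x ≤ y)
    (hy : y ≤ b) : (μp.restrict (Ioo a b)).real (Ioc x y) = lp y - lp x := by
  have h1 : Ioc x y ∩ Ioo a b = Ioc x y \ {b} := by
    ext t
    simp only [mem_inter_iff, mem_Ioc, mem_Ioo, Set.mem_sdiff, mem_singleton_iff]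
    constructor
    · exact fun ht => ⟨ht.1, ht.2.2.ne⟩
    · exact fun ht => ⟨ht.1, hx.trans_lt ht.1.1, (ht.1.2.trans hy).lt_of_ne ht.2⟩
  rw [← h.real_Ioc h0 hx hxy hy, measureReal_restrict_apply measurableSet_Ioc, h1, Measure.real,
    measure_sdiff_null (h.singleton h0 hc ⟨hab, le_rfl⟩), Measure.real]

end ArrivalMeasures

/-! ### The functions `u₋₊` and `u₊₋` -/

/-- `σ` is a finite atomless measure dominating the measures `ρm = -dλ₋`, `ρp = dλ₊` and the
signed measures `νip = d(1/λ₊)`, `νim = d(1/λ₋)`, for continuous positive rates. -/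
structure IsControl (a b : ℝ) (lm lp : ℝ → ℝ) (ρm ρp : Measure ℝ) (νip νim : SignedMeasure ℝ)
    (σ : Measure ℝ) : Prop where
  lt : a < b
  isFiniteMeasure : IsFiniteMeasure σ
  nullSingletonClass : NullSingletonClass σ
  contm : ContinuousOn lm (Icc a b)
  contp : ContinuousOn lp (Icc a b)
  posm : ∀ x ∈ Icc a b, 0 < lm x
  posp : ∀ x ∈ Icc a b, 0 < lp x
  lem : ρm ≤ σ
  lep : ρp ≤ σ
  realm : ∀ x y, a ≤ x → x ≤ y → y ≤ b → ρm.real (Ioc x y) = -lm y - -lm x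
  realp : ∀ x y, a ≤ x → x ≤ y → y ≤ b → ρp.real (Ioc x y) = lp y - lp x
  isLSp : IsLS a b (fun x => (lp x)⁻¹) νip
  isLSm : IsLS a b (fun x => (lm x)⁻¹) νim
  posPart_le_p : νip.toJordanDecomposition.posPart ≤ σ
  negPart_le_p : νip.toJordanDecomposition.negPart ≤ σ
  posPart_le_m : νim.toJordanDecomposition.posPart ≤ σ
  negPart_le_m : νim.toJordanDecomposition.negPart ≤ σ

namespace IsControl

variable {a b : ℝ} {lm lp : ℝ → ℝ} {ρm ρp : Measure ℝ} {νip νim : SignedMeasure ℝ} {σ : Measure ℝ}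

lemma contm_inv (h : IsControl a b lm lp ρm ρp νip νim σ) :
    ContinuousOn (fun x => (lm x)⁻¹) (Icc a b) :=
  h.contm.inv₀ fun x hx => (h.posm x hx).ne'

lemma contp_inv (h : IsControl a b lm lp ρm ρp νip νim σ) :
    ContinuousOn (fun x => (lp x)⁻¹) (Icc a b) :=
  h.contp.inv₀ fun x hx => (h.posp x hx).ne'

lemma isBigOm (h : IsControl a b lm lp ρm ρp νip νim σ) {x : ℝ} (hx : x ∈ Ico a b) :
    (fun y => lm y - lm x) =O[𝓝[>] x] fun y => σ.real (Ioc x y) := by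
  have := h.isFiniteMeasure
  exact (sub_isBigO_of_measureReal (f := fun x => -lm x) h.lem h.realm hx).neg_left.congr_left
    fun y => by ring

lemma isBigOp (h : IsControl a b lm lp ρm ρp νip νim σ) {x : ℝ} (hx : x ∈ Ico a b) :
    (fun y => lp y - lp x) =O[𝓝[>] x] fun y => σ.real (Ioc x y) := by
  have := h.isFiniteMeasure
  exact sub_isBigO_of_measureReal h.lep h.realp hx

lemma hasRightDiff_sInt_m (h : IsControl a b lm lp ρm ρp νip νim σ) {x : ℝ} (hx : x ∈ Ico a b) :
    HasRightDiff σ lm lp (fun y => sInt νim (fun t => (lp t)⁻¹) (Ioc a y))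
      (-(lm x ^ 2 * lp x)⁻¹) 0 x := by
  have := h.isFiniteMeasure
  have hx' := Ico_subset_Icc_self hx
  have h1 := HasRightDiff.inv (h.isBigOm hx) (h.isBigOp hx) HasRightDiff.fst (h.posm x hx').ne'
  refine (hasRightDiff_sInt h.posPart_le_m h.negPart_le_m h.isLSm h.contm_inv h.contp_inv hx
    h1).congr_coeff ?_ (by simp)
  have := (h.posm x hx').ne'
  have := (h.posp x hx').ne'
  field_simp

lemma hasRightDiff_sInt_p (h : IsControl a b lm lp ρm ρp νip νim σ) {x : ℝ} (hx : x ∈ Ico a b) :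
    HasRightDiff σ lm lp (fun y => sInt νip (fun t => (lm t)⁻¹) (Ioc a y))
      0 (-(lm x * lp x ^ 2)⁻¹) x := by
  have := h.isFiniteMeasure
  have hx' := Ico_subset_Icc_self hx
  have h1 := HasRightDiff.inv (h.isBigOm hx) (h.isBigOp hx) HasRightDiff.snd (h.posp x hx').ne'
  refine (hasRightDiff_sInt h.posPart_le_p h.negPart_le_p h.isLSp h.contp_inv h.contm_inv hx
    h1).congr_coeff (by simp) ?_
  have := (h.posm x hx').ne'
  have := (h.posp x hx').ne'
  field_simp

lemma continuousOn_sInt_m (h : IsControl a b lm lp ρm ρp νip νim σ) :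
    ContinuousOn (fun y => sInt νim (fun t => (lp t)⁻¹) (Ioc a y)) (Icc a b) :=
  continuousOn_sInt (h.isLSm.apply_singleton h.contm_inv) h.contp_inv

lemma continuousOn_sInt_p (h : IsControl a b lm lp ρm ρp νip νim σ) :
    ContinuousOn (fun y => sInt νip (fun t => (lm t)⁻¹) (Ioc a y)) (Icc a b) :=
  continuousOn_sInt (h.isLSp.apply_singleton h.contp_inv) h.contm_inv

lemma sInt_Ioc_self (ν : SignedMeasure ℝ) (g : ℝ → ℝ) (x : ℝ) : sInt ν g (Ioc x x) = 0 := by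
  simp [sInt]

lemma sInt_add_sInt (h : IsControl a b lm lp ρm ρp νip νim σ) {x : ℝ} (hx : x ∈ Icc a b) :
    sInt νim (fun t => (lp t)⁻¹) (Ioc a x) + sInt νip (fun t => (lm t)⁻¹) (Ioc a x) =
      (lm x * lp x)⁻¹ - (lm a * lp a)⁻¹ := by
  have := h.isFiniteMeasure
  have := h.nullSingletonClass
  have h1 := eq_of_hasRightDiff_zero σ (A := lm) (B := lp)
    (H := fun y => (sInt νim (fun t => (lp t)⁻¹) (Ioc a y) +
      sInt νip (fun t => (lm t)⁻¹) (Ioc a y)) - (lm y * lp y)⁻¹) hx.1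
    (((h.continuousOn_sInt_m.add h.continuousOn_sInt_p).sub ((h.contm.mul h.contp).inv₀
      fun y hy => (mul_pos (h.posm y hy) (h.posp y hy)).ne')).mono (Icc_subset_Icc_right hx.2)) ?_
  · simp only [sInt_Ioc_self] at h1
    linarith
  · intro y hy
    have hy' : y ∈ Ico a b := ⟨hy.1, hy.2.trans_le hx.2⟩
    have h2 := h.posm y (Ico_subset_Icc_self hy')
    have h3 := h.posp y (Ico_subset_Icc_self hy')
    refine (((h.hasRightDiff_sInt_m hy').add (h.hasRightDiff_sInt_p hy')).sub
      (HasRightDiff.inv (h.isBigOm hy') (h.isBigOp hy') (HasRightDiff.mul (h.isBigOm hy')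
        (h.isBigOp hy') .fst .snd) (mul_pos h2 h3).ne')).congr_coeff ?_ ?_
    · field_simp
      ring
    · field_simp
      ring

lemma Gam_eq (h : IsControl a b lm lp ρm ρp νip νim σ) :
    Gam a b lm lp νip = (lm b * lp b)⁻¹ - sInt νip (fun t => (lm t)⁻¹) (Ioc a b) := by
  rw [Gam, sInt_Icc_eq (h.isLSp.apply_singleton h.contp_inv)]

lemma Gam_eq' (h : IsControl a b lm lp ρm ρp νip νim σ) :
    Gam a b lm lp νip = (lm a * lp a)⁻¹ + sInt νim (fun t => (lp t)⁻¹) (Ioc a b) := by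
  rw [h.Gam_eq]
  linarith [h.sInt_add_sInt (right_mem_Icc.2 h.lt.le)]

lemma ump_eq (h : IsControl a b lm lp ρm ρp νip νim σ) {x : ℝ} (hx : x ∈ Icc a b) :
    ump a b lm lp νip x = (Gam a b lm lp νip)⁻¹ *
      (Gam a b lm lp νip + sInt νip (fun t => (lm t)⁻¹) (Ioc a x)) := by
  rw [ump, h.Gam_eq, ← sInt_Ioc_sub νip h.contm_inv hx.1 hx.2 le_rfl]
  ring

lemma ump_left (h : IsControl a b lm lp ρm ρp νip νim σ) (hΓ : Gam a b lm lp νip ≠ 0) :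
    ump a b lm lp νip a = 1 := by
  rw [h.ump_eq (left_mem_Icc.2 h.lt.le), sInt_Ioc_self, add_zero, inv_mul_cancel₀ hΓ]

lemma upm_right (h : IsControl a b lm lp ρm ρp νip νim σ) (hΓ : Gam a b lm lp νip ≠ 0) :
    upm a b lm lp νip νim b = 1 := by
  rw [upm, ← h.Gam_eq', inv_mul_cancel₀ hΓ]

lemma Gam_mul_add_sub_one (h : IsControl a b lm lp ρm ρp νip νim σ) (hΓ : Gam a b lm lp νip ≠ 0)
    {x : ℝ} (hx : x ∈ Icc a b) :
    Gam a b lm lp νip * (upm a b lm lp νip νim x + ump a b lm lp νip x - 1) =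
      (lm x * lp x)⁻¹ := by
  rw [h.ump_eq hx, upm, mul_sub, mul_add, mul_inv_cancel_left₀ hΓ, mul_inv_cancel_left₀ hΓ]
  linarith [h.sInt_add_sInt hx]

lemma hasRightDiff_ump (h : IsControl a b lm lp ρm ρp νip νim σ) {x : ℝ} (hx : x ∈ Ico a b) :
    HasRightDiff σ lm lp (ump a b lm lp νip) 0
      (-((Gam a b lm lp νip)⁻¹ * (lm x * lp x ^ 2)⁻¹)) x := by
  have h1 := (((HasRightDiff.const (Gam a b lm lp νip)).add
    (h.hasRightDiff_sInt_p hx)).const_mul (Gam a b lm lp νip)⁻¹).congr_coeff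
    (p' := 0) (q' := (-((Gam a b lm lp νip)⁻¹ * (lm x * lp x ^ 2)⁻¹))) (by simp) (by ring)
  refine IsLittleO.congr' h1 ?_ EventuallyEq.rfl
  filter_upwards [Ioc_mem_nhdsGT hx.2] with y hy
  rw [h.ump_eq (Ico_subset_Icc_self hx), h.ump_eq ⟨hx.1.trans hy.1.le, hy.2⟩]

lemma hasRightDiff_upm (h : IsControl a b lm lp ρm ρp νip νim σ) {x : ℝ} (hx : x ∈ Ico a b) :
    HasRightDiff σ lm lp (upm a b lm lp νip νim)
      (-((Gam a b lm lp νip)⁻¹ * (lm x ^ 2 * lp x)⁻¹)) 0 x :=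
  (((HasRightDiff.const (lm a * lp a)⁻¹).add
    (h.hasRightDiff_sInt_m hx)).const_mul (Gam a b lm lp νip)⁻¹).congr_coeff (by ring) (by simp)

lemma continuousOn_ump (h : IsControl a b lm lp ρm ρp νip νim σ) :
    ContinuousOn (ump a b lm lp νip) (Icc a b) :=
  (continuousOn_const.mul (continuousOn_const.add h.continuousOn_sInt_p)).congr
    fun _ hx => h.ump_eq hx

lemma continuousOn_upm (h : IsControl a b lm lp ρm ρp νip νim σ) :
    ContinuousOn (upm a b lm lp νip νim) (Icc a b) :=
  continuousOn_const.mul (continuousOn_const.add h.continuousOn_sInt_m)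

lemma setIntegral_ump (h : IsControl a b lm lp ρm ρp νip νim σ) (hΓ : Gam a b lm lp νip ≠ 0)
    {x y : ℝ} (hx : a ≤ x) (hxy : x ≤ y) (hy : y ≤ b) :
    ∫ t in Ioc x y, ump a b lm lp νip t ∂ρm =
      (upm a b lm lp νip νim y - 1) * lm y - (upm a b lm lp νip νim x - 1) * lm x := by
  have := h.isFiniteMeasure
  have := h.nullSingletonClass
  have : IsFiniteMeasure ρm := isFiniteMeasure_of_le σ h.lem
  have : NullSingletonClass ρm :=
    ⟨fun t => le_antisymm ((h.lem {t}).trans_eq (measure_singleton t)) zero_le⟩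
  have hsub : Icc x y ⊆ Icc a b := Icc_subset_Icc hx hy
  have h1 := eq_of_hasRightDiff_zero σ (A := lm) (B := lp)
    (H := fun y => ∫ t in Ioc x y, ump a b lm lp νip t ∂ρm -
      (upm a b lm lp νip νim y - 1) * lm y) hxy
    ((intervalIntegral.continuousOn_primitive (h.continuousOn_ump.mono hsub).integrableOn_Icc).sub
      (((h.continuousOn_upm.mono hsub).sub continuousOn_const).mul (h.contm.mono hsub))) ?_
  · simp only [Ioc_self, Measure.restrict_empty, integral_zero_measure] at h1
    linarith
  · intro t ht
    have ht' : t ∈ Ico a b := ⟨hx.trans ht.1, ht.2.trans_le hy⟩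
    have h2 := h.posm t (Ico_subset_Icc_self ht')
    have h3 := h.posp t (Ico_subset_Icc_self ht')
    have h4 := h.Gam_mul_add_sub_one hΓ (Ico_subset_Icc_self ht')
    have hneg : HasRightDiff σ lm lp (fun y => -lm y) (-1) 0 t := by
      simpa only [neg_one_mul, mul_one, mul_zero] using
        (HasRightDiff.fst (σ := σ) (A := lm) (B := lp) (x := t)).const_mul (-1)
    refine ((hasRightDiff_setIntegral h.lem h.realm h.continuousOn_ump ht' hx ht.1 hneg).sub
      (HasRightDiff.mul (h.isBigOm ht') (h.isBigOp ht')
        ((h.hasRightDiff_upm ht').sub (.const 1)) .fst)).congr_coeff ?_ ?_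
    · have h5 : ump a b lm lp νip t = (Gam a b lm lp νip)⁻¹ * (lm t * lp t)⁻¹ -
          upm a b lm lp νip νim t + 1 := by
        rw [← h4]
        field_simp
        ring
      rw [h5]
      field_simp
      ring
    · simp

lemma setIntegral_upm (h : IsControl a b lm lp ρm ρp νip νim σ) (hΓ : Gam a b lm lp νip ≠ 0)
    {x y : ℝ} (hx : a ≤ x) (hxy : x ≤ y) (hy : y ≤ b) :
    ∫ t in Ioc x y, upm a b lm lp νip νim t ∂ρp =
      (ump a b lm lp νip x - 1) * lp x - (ump a b lm lp νip y - 1) * lp y := by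
  have := h.isFiniteMeasure
  have := h.nullSingletonClass
  have : IsFiniteMeasure ρp := isFiniteMeasure_of_le σ h.lep
  have : NullSingletonClass ρp :=
    ⟨fun t => le_antisymm ((h.lep {t}).trans_eq (measure_singleton t)) zero_le⟩
  have hsub : Icc x y ⊆ Icc a b := Icc_subset_Icc hx hy
  have h1 := eq_of_hasRightDiff_zero σ (A := lm) (B := lp)
    (H := fun y => ∫ t in Ioc x y, upm a b lm lp νip νim t ∂ρp +
      (ump a b lm lp νip y - 1) * lp y) hxy
    ((intervalIntegral.continuousOn_primitive (h.continuousOn_upm.mono hsub).integrableOn_Icc).add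
      (((h.continuousOn_ump.mono hsub).sub continuousOn_const).mul (h.contp.mono hsub))) ?_
  · simp only [Ioc_self, Measure.restrict_empty, integral_zero_measure] at h1
    linarith
  · intro t ht
    have ht' : t ∈ Ico a b := ⟨hx.trans ht.1, ht.2.trans_le hy⟩
    have h2 := h.posm t (Ico_subset_Icc_self ht')
    have h3 := h.posp t (Ico_subset_Icc_self ht')
    have h4 := h.Gam_mul_add_sub_one hΓ (Ico_subset_Icc_self ht')
    refine ((hasRightDiff_setIntegral h.lep h.realp h.continuousOn_upm ht' hx ht.1 .snd).add
      (HasRightDiff.mul (h.isBigOm ht') (h.isBigOp ht')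
        ((h.hasRightDiff_ump ht').sub (.const 1)) .snd)).congr_coeff ?_ ?_
    · simp
    · have h5 : ump a b lm lp νip t = (Gam a b lm lp νip)⁻¹ * (lm t * lp t)⁻¹ -
          upm a b lm lp νip νim t + 1 := by
        rw [← h4]
        field_simp
        ring
      rw [h5]
      field_simp
      ring

end IsControl

namespace IsControl

variable {a b : ℝ} {lm lp : ℝ → ℝ} {ρm ρp : Measure ℝ} {νip νim : SignedMeasure ℝ} {σ : Measure ℝ}

lemma luckockSol_eq (h : IsControl a b lm lp ρm ρp νip νim σ) {fm fp : ℝ → ℝ}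
    (hsol : LuckockSol a b lm lp fm fp) {νlm νlp νfm νfp : SignedMeasure ℝ}
    (hlm : IsLS a b lm νlm) (hlp : IsLS a b lp νlp) (hfm : IsLS a b fm νfm)
    (hfp : IsLS a b fp νfp)
    (hσ : ∀ ν ∈ [νlm, νlp, νfm, νfp], ν.toJordanDecomposition.posPart ≤ σ ∧
      ν.toJordanDecomposition.negPart ≤ σ) :
    Gam a b lm lp νip ≠ 0 ∧ ∀ z ∈ Icc a b,
      fm z = lm z * (((lm b)⁻¹ + (lp a)⁻¹) * upm a b lm lp νip νim z - (lp a)⁻¹) ∧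
      fp z = lp z * (((lm b)⁻¹ + (lp a)⁻¹) * ump a b lm lp νip z - (lm b)⁻¹) := by
  obtain ⟨hcm, hcp, -, -, hmb, hpa, heq⟩ := hsol
  simp only [List.forall_mem_cons, List.not_mem_nil, false_implies, implies_true, and_true] at hσ
  obtain ⟨⟨h1, h2⟩, ⟨h3, h4⟩, ⟨h5, h6⟩, h7, h8⟩ := hσ
  have := h.isFiniteMeasure
  have := h.nullSingletonClass
  have hdp : ∀ x ∈ Ico a b, HasRightDiff σ lm lp fp 0 (-(fm x / lm x)) x := fun x hx =>
    (hasRightDiff_of_sInt_add_eq_zero h3 h4 h7 h8 hlp hfp h.contp hcp hcm h.contm hx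
      (fun s hs => (heq νlm νlp νfm νfp hlm hlp hfm hfp s hs).1)
      (h.posm x (Ico_subset_Icc_self hx)).ne' .snd).congr_coeff (mul_zero _) (mul_one _)
  have hdm : ∀ x ∈ Ico a b, HasRightDiff σ lm lp fm (-(fp x / lp x)) 0 x := fun x hx =>
    (hasRightDiff_of_sInt_add_eq_zero h1 h2 h5 h6 hlm hfm h.contm hcm hcp h.contp hx
      (fun s hs => (heq νlm νlp νfm νfp hlm hlp hfm hfp s hs).2)
      (h.posp x (Ico_subset_Icc_self hx)).ne' .fst).congr_coeff (mul_one _) (mul_zero _)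
  set K := fm a * lp a + fp a * lm a with hK
  have hconst : ∀ z ∈ Icc a b, fm z * lp z + fp z * lm z = K := by
    intro z hz
    refine eq_of_hasRightDiff_zero σ (A := lm) (B := lp)
      (H := fun y => fm y * lp y + fp y * lm y) hz.1
      (((hcm.mul h.contp).add (hcp.mul h.contm)).mono (Icc_subset_Icc_right hz.2)) ?_
    intro x hx
    have hx' : x ∈ Ico a b := ⟨hx.1, hx.2.trans_le hz.2⟩
    have h2 := h.posm x (Ico_subset_Icc_self hx')
    have h3 := h.posp x (Ico_subset_Icc_self hx')
    refine ((HasRightDiff.mul (h.isBigOm hx') (h.isBigOp hx') (hdm x hx') .snd).add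
      (HasRightDiff.mul (h.isBigOm hx') (h.isBigOp hx') (hdp x hx') .fst)).congr_coeff ?_ ?_
    · field_simp
      ring
    · field_simp
      ring
  have hA := h.posm a (left_mem_Icc.2 h.lt.le)
  have hB := h.posp a (left_mem_Icc.2 h.lt.le)
  have hmain : ∀ z ∈ Icc a b, fm z * (lm z)⁻¹ =
      K * ((lm a * lp a)⁻¹ + sInt νim (fun t => (lp t)⁻¹) (Ioc a z)) - (lp a)⁻¹ := by
    intro z hz
    have h9 := eq_of_hasRightDiff_zero σ (A := lm) (B := lp)
      (H := fun y => fm y * (lm y)⁻¹ - K * sInt νim (fun t => (lp t)⁻¹) (Ioc a y)) hz.1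
      (((hcm.mul h.contm_inv).sub (continuousOn_const.mul h.continuousOn_sInt_m)).mono
        (Icc_subset_Icc_right hz.2)) ?_
    · simp only [sInt_Ioc_self] at h9
      have h10 : fm a * (lm a)⁻¹ = K * (lm a * lp a)⁻¹ - (lp a)⁻¹ := by
        rw [hK, hpa]
        field_simp
        ring
      linarith
    · intro x hx
      have hx' : x ∈ Ico a b := ⟨hx.1, hx.2.trans_le hz.2⟩
      have h2 := h.posm x (Ico_subset_Icc_self hx')
      have h3 := h.posp x (Ico_subset_Icc_self hx')
      refine ((HasRightDiff.mul (h.isBigOm hx') (h.isBigOp hx') (hdm x hx')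
        (HasRightDiff.inv (h.isBigOm hx') (h.isBigOp hx') .fst h2.ne')).sub
        ((h.hasRightDiff_sInt_m hx').const_mul K)).congr_coeff ?_ (by simp)
      rw [← hconst x (Ico_subset_Icc_self hx')]
      field_simp
      ring
  have hb := hmain b (right_mem_Icc.2 h.lt.le)
  rw [hmb, one_mul, ← h.Gam_eq'] at hb
  have hκ : K * Gam a b lm lp νip = (lm b)⁻¹ + (lp a)⁻¹ := by linarith
  have hΓ : Gam a b lm lp νip ≠ 0 := by
    intro h0
    rw [h0, mul_zero] at hκ
    have := inv_pos.2 (h.posm b (right_mem_Icc.2 h.lt.le))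
    have := inv_pos.2 hB
    linarith
  have hm : ∀ z ∈ Icc a b, fm z =
      lm z * (((lm b)⁻¹ + (lp a)⁻¹) * upm a b lm lp νip νim z - (lp a)⁻¹) := by
    intro z hz
    have hz0 := (h.posm z hz).ne'
    rw [← hκ, upm, mul_assoc, mul_inv_cancel_left₀ hΓ, ← hmain z hz]
    field_simp
  refine ⟨hΓ, fun z hz => ⟨hm z hz, ?_⟩⟩
  have h9 := h.Gam_mul_add_sub_one hΓ hz
  have h10 := hconst z hz
  have hz1 := h.posm z hz
  have hz2 := h.posp z hz
  rw [hm z hz] at h10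
  have h11 : K * (lm z * lp z)⁻¹ = ((lm b)⁻¹ + (lp a)⁻¹) *
      (upm a b lm lp νip νim z + ump a b lm lp νip z - 1) := by
    rw [← h9, ← hκ]
    ring
  have h12 : K = lm z * lp z * (((lm b)⁻¹ + (lp a)⁻¹) *
      (upm a b lm lp νip νim z + ump a b lm lp νip z - 1)) := by
    rw [← h11]
    field_simp
  refine mul_right_cancel₀ hz1.ne' ?_
  linear_combination h10 + h12

end IsControl

lemma nullSingletonClass_add {μ ν : Measure ℝ} (hμ : NullSingletonClass μ)
    (hν : NullSingletonClass ν) : NullSingletonClass (μ + ν) :=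
  ⟨fun x => by simp⟩

lemma exists_finite_nullSingletonClass_ge (τ : List (Measure ℝ))
    (hτ : ∀ ρ ∈ τ, IsFiniteMeasure ρ ∧ NullSingletonClass ρ) :
    ∃ σ : Measure ℝ, IsFiniteMeasure σ ∧ NullSingletonClass σ ∧ ∀ ρ ∈ τ, ρ ≤ σ := by
  induction τ with
  | nil => exact ⟨0, inferInstance, ⟨fun _ => rfl⟩, by simp⟩
  | cons ρ τ ih =>
    obtain ⟨⟨h1, h2⟩, h3⟩ := List.forall_mem_cons.1 hτ
    obtain ⟨σ, h4, h5, h6⟩ := ih h3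
    refine ⟨ρ + σ, inferInstance, nullSingletonClass_add h2 h5, List.forall_mem_cons.2
      ⟨Measure.le_add_right le_rfl, fun ρ' hρ' => Measure.le_add_left (h6 ρ' hρ')⟩⟩

/-- Continuous functions of bounded variation have their total variation measures dominated by a
common finite atomless measure. -/
lemma exists_isControl {a b : ℝ} {lm lp fm fp : ℝ → ℝ} (hab : a < b) (hA3 : A3 a b lm lp)
    (hA6 : A6 a b lm lp) (hsol : LuckockSol a b lm lp fm fp) {μm μp : Measure ℝ}
    (hμm : IsMuMinus a b lm μm) (hμp : IsMuPlus a b lp μp) {νip νim : SignedMeasure ℝ}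
    (hνip : IsLS a b (fun x => (lp x)⁻¹) νip) (hνim : IsLS a b (fun x => (lm x)⁻¹) νim) :
    ∃ (σ : Measure ℝ) (νlm νlp νfm νfp : SignedMeasure ℝ),
      IsControl a b lm lp (μm.restrict (Ioo a b)) (μp.restrict (Ioo a b)) νip νim σ ∧
      IsLS a b lm νlm ∧ IsLS a b lp νlp ∧ IsLS a b fm νfm ∧ IsLS a b fp νfp ∧
      ∀ ν ∈ [νlm, νlp, νfm, νfp], ν.toJordanDecomposition.posPart ≤ σ ∧
        ν.toJordanDecomposition.negPart ≤ σ := by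
  obtain ⟨hcm, hcp, hm, hp, hm0, hp0⟩ := hA3
  have hposm : ∀ x ∈ Icc a b, 0 < lm x := fun x hx =>
    hA6.2.trans_le (hm hx (right_mem_Icc.2 hab.le) hx.2)
  have hposp : ∀ x ∈ Icc a b, 0 < lp x := fun x hx =>
    hA6.1.trans_le (hp (left_mem_Icc.2 hab.le) hx hx.1)
  have hbp : BoundedVariationOn lp (Icc a b) := by
    have := hp.locallyBoundedVariationOn a b (left_mem_Icc.2 hab.le) (right_mem_Icc.2 hab.le)
    rwa [inter_self] at this
  have hbm : BoundedVariationOn lm (Icc a b) := by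
    have := hm.neg.locallyBoundedVariationOn a b (left_mem_Icc.2 hab.le) (right_mem_Icc.2 hab.le)
    rw [inter_self] at this
    simpa [Function.comp_def] using
      (LipschitzWith.id (α := ℝ)).neg.comp_boundedVariationOn this
  obtain ⟨νlm, hlm⟩ := exists_isLS hab.le hcm hbm
  obtain ⟨νlp, hlp⟩ := exists_isLS hab.le hcp hbp
  obtain ⟨νfm, hfm⟩ := exists_isLS hab.le hsol.1 hsol.2.2.1
  obtain ⟨νfp, hfp⟩ := exists_isLS hab.le hsol.2.1 hsol.2.2.2.1
  have hcm' : ContinuousOn (fun x => (lm x)⁻¹) (Icc a b) :=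
    hcm.inv₀ fun x hx => (hposm x hx).ne'
  have hcp' : ContinuousOn (fun x => (lp x)⁻¹) (Icc a b) :=
    hcp.inv₀ fun x hx => (hposp x hx).ne'
  have hfinm := hμm.isFiniteMeasure hab.le
  have hfinp := hμp.isFiniteMeasure hab.le
  have htv : ∀ ν : SignedMeasure ℝ, (∀ x, ν {x} = 0) → IsFiniteMeasure ν.totalVariation ∧
      NullSingletonClass ν.totalVariation := by
    intro ν hν
    obtain ⟨h1, h2⟩ := nullSingletonClass_jordan hν
    exact ⟨by unfold SignedMeasure.totalVariation; infer_instance, nullSingletonClass_add h1 h2⟩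
  have hpos : ∀ ν : SignedMeasure ℝ, ν.toJordanDecomposition.posPart ≤ ν.totalVariation :=
    fun ν => Measure.le_add_right le_rfl
  have hneg : ∀ ν : SignedMeasure ℝ, ν.toJordanDecomposition.negPart ≤ ν.totalVariation :=
    fun ν => Measure.le_add_left le_rfl
  have t1 := htv νlm (hlm.apply_singleton hcm)
  have t2 := htv νlp (hlp.apply_singleton hcp)
  have t3 := htv νfm (hfm.apply_singleton hsol.1)
  have t4 := htv νfp (hfp.apply_singleton hsol.2.1)
  have t5 := htv νip (hνip.apply_singleton hcp')
  have t6 := htv νim (hνim.apply_singleton hcm')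
  have t7 : NullSingletonClass (μm.restrict (Ioo a b)) :=
    nullSingletonClass_restrict fun t ht => hμm.singleton hm0 hcm (Ioo_subset_Ico_self ht)
  have t8 : NullSingletonClass (μp.restrict (Ioo a b)) :=
    nullSingletonClass_restrict fun t ht => hμp.singleton hp0 hcp (Ioo_subset_Ioc_self ht)
  obtain ⟨σ, hσ, hσ', hle⟩ := exists_finite_nullSingletonClass_ge [νlm.totalVariation,
    νlp.totalVariation, νfm.totalVariation, νfp.totalVariation, νip.totalVariation,
    νim.totalVariation, μm.restrict (Ioo a b), μp.restrict (Ioo a b)] (by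
      simp only [List.forall_mem_cons, List.not_mem_nil, false_implies, implies_true, and_true]
      exact ⟨t1, t2, t3, t4, t5, t6, ⟨inferInstance, t7⟩, inferInstance, t8⟩)
  simp only [List.forall_mem_cons, List.not_mem_nil, false_implies, implies_true,
    and_true] at hle
  obtain ⟨l1, l2, l3, l4, l5, l6, l7, l8⟩ := hle
  refine ⟨σ, νlm, νlp, νfm, νfp, ⟨hab, hσ, hσ', hcm, hcp, hposm, hposp, l7, l8, ?_, ?_, hνip,
    hνim, (hpos _).trans l5, (hneg _).trans l5, (hpos _).trans l6, (hneg _).trans l6⟩,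
    hlm, hlp, hfm, hfp, ?_⟩
  · intro x y hx hxy hy
    rw [hμm.restrict_real_Ioc hm0 hcm hab hx hxy hy]
    ring
  · exact fun x y hx hxy hy => hμp.restrict_real_Ioc hp0 hcp hab hx hxy hy
  · simp only [List.forall_mem_cons, List.not_mem_nil, false_implies, implies_true, and_true]
    exact ⟨⟨(hpos _).trans l1, (hneg _).trans l1⟩, ⟨(hpos _).trans l2, (hneg _).trans l2⟩,
      ⟨(hpos _).trans l3, (hneg _).trans l3⟩, (hpos _).trans l4, (hneg _).trans l4⟩

/-! ### The generator applied to a linear functional -/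

namespace IsConfig

variable {a b : ℝ} {X : OrderBook}

lemma isLUB_Mminus (X : OrderBook) (a : ℝ) : IsLUB (insert a {x | x ∈ X.minus}) (Mminus a X) :=
  isLUB_csSup (insert_nonempty _ _) ((X.minus.finite_toSet.insert a).bddAbove)

lemma isGLB_Mplus (X : OrderBook) (b : ℝ) : IsGLB (insert b {x | x ∈ X.plus}) (Mplus b X) :=
  isGLB_csInf (insert_nonempty _ _) ((X.plus.finite_toSet.insert b).bddBelow)

lemma Mminus_mem (h : IsConfig a b X) (h0 : X.minus ≠ 0) : Mminus a X ∈ X.minus := by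
  rcases (insert_nonempty a {x | x ∈ X.minus}).csSup_mem (X.minus.finite_toSet.insert a) with
    h1 | h1
  · obtain ⟨x, hx⟩ := Multiset.exists_mem_of_ne_zero h0
    have h2 : x ≤ Mminus a X := (isLUB_Mminus X a).1 (mem_insert_of_mem _ hx)
    exact absurd (h2.trans_eq h1) (not_le.2 (h.1 x hx).1)
  · exact h1

lemma Mplus_mem (h : IsConfig a b X) (h0 : X.plus ≠ 0) : Mplus b X ∈ X.plus := by
  rcases (insert_nonempty b {x | x ∈ X.plus}).csInf_mem (X.plus.finite_toSet.insert b) with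
    h1 | h1
  · obtain ⟨x, hx⟩ := Multiset.exists_mem_of_ne_zero h0
    have h2 : Mplus b X ≤ x := (isGLB_Mplus X b).1 (mem_insert_of_mem _ hx)
    exact absurd (h1.symm.trans_le h2) (not_le.2 (h.2.1 x hx).2)
  · exact h1

lemma Mminus_eq_left (h0 : X.minus = 0) : Mminus a X = a := by
  simp [Mminus, h0]

lemma Mplus_eq_right (h0 : X.plus = 0) : Mplus b X = b := by
  simp [Mplus, h0]

lemma Mminus_mem_Ico (h : IsConfig a b X) (hab : a < b) : Mminus a X ∈ Ico a b := by
  by_cases h0 : X.minus = 0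
  · rw [Mminus_eq_left h0]
    exact left_mem_Ico.2 hab
  · exact Ioo_subset_Ico_self (h.1 _ (h.Mminus_mem h0))

lemma Mplus_mem_Ioc (h : IsConfig a b X) (hab : a < b) : Mplus b X ∈ Ioc a b := by
  by_cases h0 : X.plus = 0
  · rw [Mplus_eq_right h0]
    exact right_mem_Ioc.2 hab
  · exact Ioo_subset_Ioc_self (h.2.1 _ (h.Mplus_mem h0))

lemma linF_Lminus_sub (h : IsConfig a b X) {wm wp : ℝ → ℝ} (hb : wp b = 0) {u : ℝ}
    (hu : u ∈ Ioc a b) :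
    linF wm wp (Lminus a b u X) - linF wm wp X =
      (Icc (Mplus b X) b).indicator (fun _ => -wp (Mplus b X)) u +
        (Ioo a (Mplus b X)).indicator wm u := by
  have hpb := (isGLB_Mplus X b).1 (mem_insert b _)
  rcases le_or_gt (Mplus b X) u with h1 | h1
  · rw [indicator_of_mem (mem_Icc.2 ⟨h1, hu.2⟩), indicator_of_notMem fun h2 => not_lt.2 h1 h2.2,
      add_zero]
    by_cases h0 : X.plus = 0
    · rw [Mplus_eq_right h0, hb]
      have h2 : ¬ u < b := not_lt.2 (h1.trans_eq' (Mplus_eq_right h0))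
      simp [Lminus, h0, h2]
    · have h2 : (X.plus.map wp).sum =
          wp (Mplus b X) + ((X.plus.erase (Mplus b X)).map wp).sum := by
        rw [← Multiset.sum_cons, ← Multiset.map_cons, Multiset.cons_erase (h.Mplus_mem h0)]
      rw [Lminus, if_pos ⟨h0, h1⟩, linF, linF, h2]
      ring
  · rw [indicator_of_notMem fun h2 => not_lt.2 h2.1 h1, indicator_of_mem (mem_Ioo.2 ⟨hu.1, h1⟩),
      Lminus, if_neg fun h2 => not_lt.2 h2.2 h1, if_pos ⟨hu.1, h1.trans_le hpb⟩, linF, linF,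
      Multiset.map_cons, Multiset.sum_cons]
    ring

lemma linF_Lplus_sub (h : IsConfig a b X) {wm wp : ℝ → ℝ} (ha : wm a = 0) {u : ℝ}
    (hu : u ∈ Ico a b) :
    linF wm wp (Lplus a b u X) - linF wm wp X =
      (Icc a (Mminus a X)).indicator (fun _ => -wm (Mminus a X)) u +
        (Ioo (Mminus a X) b).indicator wp u := by
  have hma := (isLUB_Mminus X a).1 (mem_insert a _)
  rcases le_or_gt u (Mminus a X) with h1 | h1
  · rw [indicator_of_mem (mem_Icc.2 ⟨hu.1, h1⟩), indicator_of_notMem fun h2 => not_lt.2 h1 h2.1,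
      add_zero]
    by_cases h0 : X.minus = 0
    · rw [Mminus_eq_left h0, ha]
      have h2 : ¬ a < u := not_lt.2 (h1.trans_eq (Mminus_eq_left h0))
      simp [Lplus, h0, h2]
    · have h2 : (X.minus.map wm).sum =
          wm (Mminus a X) + ((X.minus.erase (Mminus a X)).map wm).sum := by
        rw [← Multiset.sum_cons, ← Multiset.map_cons, Multiset.cons_erase (h.Mminus_mem h0)]
      rw [Lplus, if_pos ⟨h0, h1⟩, linF, linF, h2]
      ring
  · rw [indicator_of_notMem fun h2 => not_lt.2 h2.2 h1, indicator_of_mem (mem_Ioo.2 ⟨h1, hu.2⟩),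
      Lplus, if_neg fun h2 => not_lt.2 h2.2 h1, if_pos ⟨hma.trans_lt h1, hu.2⟩, linF, linF,
      Multiset.map_cons, Multiset.sum_cons]
    ring

lemma integral_Lminus (h : IsConfig a b X) (hab : a < b) {lm : ℝ → ℝ}
    (hc : ContinuousOn lm (Icc a b)) (h0 : ∀ x ∈ Icc a b, 0 ≤ lm x) {μm : Measure ℝ}
    (hμ : IsMuMinus a b lm μm) {wm wp : ℝ → ℝ} (hw : Integrable wm (μm.restrict (Ioo a b)))
    (hb : wp b = 0) :
    ∫ u, (linF wm wp (Lminus a b u X) - linF wm wp X) ∂μm =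
      -(wp (Mplus b X) * lm (Mplus b X)) +
        ∫ u in Ioc a (Mplus b X), wm u ∂(μm.restrict (Ioo a b)) := by
  have := hμ.isFiniteMeasure hab.le
  have := nullSingletonClass_restrict (μ := μm) (s := Ioo a b)
    fun t ht => hμ.singleton h0 hc (Ioo_subset_Ico_self ht)
  have hp := h.Mplus_mem_Ioc hab
  have hae : ∀ᵐ u ∂μm, u ∈ Ioc a b := by
    filter_upwards [(compl_mem_ae_iff.2 (hμ.singleton h0 hc (left_mem_Ico.2 hab))),
      (mem_ae_iff.2 hμ.2)] with u h1 h2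
    exact ⟨h2.1.lt_of_ne' h1, h2.2⟩
  have hsub : Ioo a (Mplus b X) ⊆ Ioo a b := Ioo_subset_Ioo_right hp.2
  rw [integral_congr_ae (hae.mono fun u hu => h.linF_Lminus_sub hb hu), integral_add
    ((integrable_const _).indicator measurableSet_Icc)
    ((integrable_indicator_iff measurableSet_Ioo).2 (IntegrableOn.mono_set hw hsub)),
    integral_indicator_const _ measurableSet_Icc, integral_indicator measurableSet_Ioo,
    hμ.real_Icc h0 (Ioc_subset_Icc_self hp), integral_Ioc_eq_integral_Ioo,
    Measure.restrict_restrict measurableSet_Ioo, inter_eq_self_of_subset_left hsub, smul_eq_mul]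
  ring

lemma integral_Lplus (h : IsConfig a b X) (hab : a < b) {lp : ℝ → ℝ}
    (hc : ContinuousOn lp (Icc a b)) (h0 : ∀ x ∈ Icc a b, 0 ≤ lp x) {μp : Measure ℝ}
    (hμ : IsMuPlus a b lp μp) {wm wp : ℝ → ℝ} (hw : Integrable wp (μp.restrict (Ioo a b)))
    (ha : wm a = 0) :
    ∫ u, (linF wm wp (Lplus a b u X) - linF wm wp X) ∂μp =
      -(wm (Mminus a X) * lp (Mminus a X)) +
        ∫ u in Ioc (Mminus a X) b, wp u ∂(μp.restrict (Ioo a b)) := by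
  have := hμ.isFiniteMeasure hab.le
  have := nullSingletonClass_restrict (μ := μp) (s := Ioo a b)
    fun t ht => hμ.singleton h0 hc (Ioo_subset_Ioc_self ht)
  have hp := h.Mminus_mem_Ico hab
  have hae : ∀ᵐ u ∂μp, u ∈ Ico a b := by
    filter_upwards [(compl_mem_ae_iff.2 (hμ.singleton h0 hc (right_mem_Ioc.2 hab))),
      (mem_ae_iff.2 hμ.2)] with u h1 h2
    exact ⟨h2.1, h2.2.lt_of_ne h1⟩
  have hsub : Ioo (Mminus a X) b ⊆ Ioo a b := Ioo_subset_Ioo_left hp.1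
  rw [integral_congr_ae (hae.mono fun u hu => h.linF_Lplus_sub ha hu), integral_add
    ((integrable_const _).indicator measurableSet_Icc)
    ((integrable_indicator_iff measurableSet_Ioo).2 (IntegrableOn.mono_set hw hsub)),
    integral_indicator_const _ measurableSet_Icc, integral_indicator measurableSet_Ioo,
    hμ.real_Icc h0 (Ico_subset_Icc_self hp), integral_Ioc_eq_integral_Ioo,
    Measure.restrict_restrict measurableSet_Ioo, inter_eq_self_of_subset_left hsub, smul_eq_mul]
  ring

end IsConfig

lemma integrableOn_and_setIntegral_of_piecewise {ρ : Measure ℝ} [IsFiniteMeasure ρ]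
    [NullSingletonClass ρ] {a b z : ℝ} {w g₁ g₂ : ℝ → ℝ} (hg₁ : ContinuousOn g₁ (Icc a b))
    (hg₂ : ContinuousOn g₂ (Icc a b)) (hw₁ : ∀ t, t < z → w t = g₁ t)
    (hw₂ : ∀ t, z < t → w t = g₂ t) {x y : ℝ} (hx : a ≤ x) (hxy : x ≤ y) (hy : y ≤ b) :
    IntegrableOn w (Ioc x y) ρ ∧ ∫ t in Ioc x y, w t ∂ρ =
      ∫ t in Ioc x (max x (min y z)), g₁ t ∂ρ + ∫ t in Ioc (max x (min y z)) y, g₂ t ∂ρ := by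
  set c := max x (min y z) with hc
  have hxc : x ≤ c := le_max_left _ _
  have hcy : c ≤ y := max_le hxy (min_le_left _ _)
  have hz : ∀ᵐ t ∂ρ, t ≠ z := compl_mem_ae_iff.2 (measure_singleton z)
  have e₁ : ∀ᵐ t ∂ρ, t ∈ Ioc x c → w t = g₁ t := by
    filter_upwards [hz] with t ht h1
    have h2 : t ≤ min y z := (le_max_iff.1 h1.2).resolve_left (not_le.2 h1.1)
    exact hw₁ t ((h2.trans (min_le_right _ _)).lt_of_ne ht)
  have e₂ : ∀ᵐ t ∂ρ, t ∈ Ioc c y → w t = g₂ t := by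
    refine Eventually.of_forall fun t h1 => hw₂ t ?_
    have h2 : min y z < t := (le_max_right _ _).trans_lt h1.1
    exact (min_lt_iff.1 h2).resolve_left (not_lt.2 h1.2)
  have i₁ : IntegrableOn w (Ioc x c) ρ := IntegrableOn.congr_fun_ae
    (hg₁.integrableOn_Icc.mono_set (Ioc_subset_Icc_self.trans (Icc_subset_Icc hx (hcy.trans hy))))
    ((ae_restrict_iff' measurableSet_Ioc).2 (e₁.mono fun t ht h => (ht h).symm))
  have i₂ : IntegrableOn w (Ioc c y) ρ := IntegrableOn.congr_fun_ae
    (hg₂.integrableOn_Icc.mono_set (Ioc_subset_Icc_self.trans (Icc_subset_Icc (hx.trans hxc) hy)))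
    ((ae_restrict_iff' measurableSet_Ioc).2 (e₂.mono fun t ht h => (ht h).symm))
  rw [← Ioc_union_Ioc_eq_Ioc hxc hcy]
  refine ⟨i₁.union i₂, ?_⟩
  rw [setIntegral_union (Ioc_disjoint_Ioc_of_le le_rfl) measurableSet_Ioc i₁ i₂,
    setIntegral_congr_ae measurableSet_Ioc e₁, setIntegral_congr_ae measurableSet_Ioc e₂]

/-! ### The special weight functions -/

namespace IsControl

variable {a b : ℝ} {lm lp : ℝ → ℝ} {ρm ρp : Measure ℝ} {νip νim : SignedMeasure ℝ} {σ : Measure ℝ}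

lemma setIntegral_ump_sub_one (h : IsControl a b lm lp ρm ρp νip νim σ)
    (hΓ : Gam a b lm lp νip ≠ 0) {x y : ℝ} (hx : a ≤ x) (hxy : x ≤ y) (hy : y ≤ b) :
    ∫ t in Ioc x y, (ump a b lm lp νip t - 1) ∂ρm =
      upm a b lm lp νip νim y * lm y - upm a b lm lp νip νim x * lm x := by
  have := h.isFiniteMeasure
  have : IsFiniteMeasure ρm := isFiniteMeasure_of_le σ h.lem
  rw [integral_sub (h.continuousOn_ump.integrableOn_Icc.mono_set
    (Ioc_subset_Icc_self.trans (Icc_subset_Icc hx hy))) (integrable_const _),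
    h.setIntegral_ump hΓ hx hxy hy, setIntegral_const, h.realm x y hx hxy hy, smul_eq_mul]
  ring

lemma setIntegral_upm_sub_one (h : IsControl a b lm lp ρm ρp νip νim σ)
    (hΓ : Gam a b lm lp νip ≠ 0) {x y : ℝ} (hx : a ≤ x) (hxy : x ≤ y) (hy : y ≤ b) :
    ∫ t in Ioc x y, (upm a b lm lp νip νim t - 1) ∂ρp =
      ump a b lm lp νip x * lp x - ump a b lm lp νip y * lp y := by
  have := h.isFiniteMeasure
  have : IsFiniteMeasure ρp := isFiniteMeasure_of_le σ h.lep
  rw [integral_sub (h.continuousOn_upm.integrableOn_Icc.mono_set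
    (Ioc_subset_Icc_self.trans (Icc_subset_Icc hx hy))) (integrable_const _),
    h.setIntegral_upm hΓ hx hxy hy, setIntegral_const, h.realp x y hx hxy hy, smul_eq_mul]
  ring

lemma Gam_mul_upm_left (h : IsControl a b lm lp ρm ρp νip νim σ) (hΓ : Gam a b lm lp νip ≠ 0) :
    Gam a b lm lp νip * upm a b lm lp νip νim a * lm a = (lp a)⁻¹ := by
  have := (h.posm a (left_mem_Icc.2 h.lt.le)).ne'
  rw [upm, sInt_Ioc_self, add_zero, mul_inv_cancel_left₀ hΓ]
  field_simp

lemma Gam_mul_ump_right (h : IsControl a b lm lp ρm ρp νip νim σ) (hΓ : Gam a b lm lp νip ≠ 0) :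
    Gam a b lm lp νip * ump a b lm lp νip b * lp b = (lm b)⁻¹ := by
  have := (h.posp b (right_mem_Icc.2 h.lt.le)).ne'
  rw [ump, sInt_Ioc_self, sub_zero, mul_inv_cancel_left₀ hΓ]
  field_simp

lemma setIntegral_wzmm (h : IsControl a b lm lp ρm ρp νip νim σ) (hΓ : Gam a b lm lp νip ≠ 0)
    {z p : ℝ} (hz : z ∈ Icc a b) (hp : p ∈ Icc a b) :
    IntegrableOn (wzmm a b lm lp νip νim z) (Ioc a p) ρm ∧
    ∫ t in Ioc a p, wzmm a b lm lp νip νim z t ∂ρm =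
      wzmp a b lm lp νip νim z p * lm p -
        lm z * (upm a b lm lp νip νim z - 1) * (lp a)⁻¹ := by
  have := h.isFiniteMeasure
  have := h.nullSingletonClass
  have : IsFiniteMeasure ρm := isFiniteMeasure_of_le σ h.lem
  have : NullSingletonClass ρm :=
    ⟨fun t => le_antisymm ((h.lem {t}).trans_eq (measure_singleton t)) zero_le⟩
  set U := upm a b lm lp νip νim with hU
  set V := ump a b lm lp νip with hV
  obtain ⟨h1, h2⟩ := integrableOn_and_setIntegral_of_piecewise (ρ := ρm) (z := z)
    (w := wzmm a b lm lp νip νim z)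
    (g₁ := fun t => (lm z * Gam a b lm lp νip * (U z - 1)) * (V t - 1))
    (g₂ := fun t => (lm z * Gam a b lm lp νip * U z) * V t)
    (continuousOn_const.mul (h.continuousOn_ump.sub continuousOn_const))
    (continuousOn_const.mul h.continuousOn_ump)
    (fun t ht => by simp [wzmm, ht.le, hU, hV])
    (fun t ht => by simp [wzmm, not_le.2 ht, hU, hV]) le_rfl hp.1 hp.2
  refine ⟨h1, ?_⟩
  rw [h2, integral_const_mul, integral_const_mul, ← h.Gam_mul_upm_left hΓ]
  rcases le_total p z with hpz | hpz
  · rw [min_eq_left hpz, max_eq_right hp.1, h.setIntegral_ump_sub_one hΓ le_rfl hp.1 hp.2,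
      Ioc_self, Measure.restrict_empty, integral_zero_measure, wzmp, max_eq_right hpz,
      min_eq_left hpz]
    ring
  · rw [min_eq_right hpz, max_eq_right hz.1, h.setIntegral_ump_sub_one hΓ le_rfl hz.1 hz.2,
      h.setIntegral_ump hΓ hz.1 hpz hp.2, wzmp, max_eq_left hpz, min_eq_right hpz]
    ring

lemma setIntegral_wzmp (h : IsControl a b lm lp ρm ρp νip νim σ) (hΓ : Gam a b lm lp νip ≠ 0)
    {z m : ℝ} (hz : z ∈ Icc a b) (hm : m ∈ Icc a b) :
    IntegrableOn (wzmp a b lm lp νip νim z) (Ioc m b) ρp ∧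
    ∫ t in Ioc m b, wzmp a b lm lp νip νim z t ∂ρp =
      wzmm a b lm lp νip νim z m * lp m + (if m ≤ z then 1 else 0) -
        lm z * upm a b lm lp νip νim z * (lm b)⁻¹ := by
  have := h.isFiniteMeasure
  have := h.nullSingletonClass
  have : IsFiniteMeasure ρp := isFiniteMeasure_of_le σ h.lep
  have : NullSingletonClass ρp :=
    ⟨fun t => le_antisymm ((h.lep {t}).trans_eq (measure_singleton t)) zero_le⟩
  set U := upm a b lm lp νip νim with hU
  set V := ump a b lm lp νip with hV
  obtain ⟨h1, h2⟩ := integrableOn_and_setIntegral_of_piecewise (ρ := ρp) (z := z)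
    (w := wzmp a b lm lp νip νim z)
    (g₁ := fun t => (lm z * Gam a b lm lp νip * (U z - 1)) * U t)
    (g₂ := fun t => (lm z * Gam a b lm lp νip * U z) * (U t - 1))
    (continuousOn_const.mul h.continuousOn_upm)
    (continuousOn_const.mul (h.continuousOn_upm.sub continuousOn_const))
    (fun t ht => by simp [wzmp, ht.le, hU])
    (fun t ht => by simp only [wzmp, max_eq_left ht.le, min_eq_right ht.le, hU]; ring)
    hm.1 hm.2 le_rfl
  refine ⟨h1, ?_⟩
  rw [h2, integral_const_mul, integral_const_mul, ← h.Gam_mul_ump_right hΓ, min_eq_right hz.2]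
  rcases le_or_gt m z with hmz | hmz
  · have hone : lm z * lp z * (Gam a b lm lp νip * (U z + V z - 1)) = 1 := by
      rw [h.Gam_mul_add_sub_one hΓ hz,
        mul_inv_cancel₀ (mul_pos (h.posm z hz) (h.posp z hz)).ne']
    rw [max_eq_right hmz, h.setIntegral_upm hΓ hm.1 hmz hz.2,
      h.setIntegral_upm_sub_one hΓ hz.1 hz.2 le_rfl, wzmm, if_pos hmz]
    linear_combination hone
  · rw [max_eq_left hmz.le, Ioc_self, Measure.restrict_empty, integral_zero_measure,
      h.setIntegral_upm_sub_one hΓ hm.1 hm.2 le_rfl, wzmm, if_neg (not_le.2 hmz)]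
    ring

lemma setIntegral_wzpm (h : IsControl a b lm lp ρm ρp νip νim σ) (hΓ : Gam a b lm lp νip ≠ 0)
    {z p : ℝ} (hz : z ∈ Icc a b) (hp : p ∈ Icc a b) :
    IntegrableOn (wzpm a b lm lp νip νim z) (Ioc a p) ρm ∧
    ∫ t in Ioc a p, wzpm a b lm lp νip νim z t ∂ρm =
      wzpp a b lm lp νip νim z p * lm p + (if z ≤ p then 1 else 0) -
        lp z * ump a b lm lp νip z * (lp a)⁻¹ := by
  have := h.isFiniteMeasure
  have := h.nullSingletonClass
  have : IsFiniteMeasure ρm := isFiniteMeasure_of_le σ h.lem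
  have : NullSingletonClass ρm :=
    ⟨fun t => le_antisymm ((h.lem {t}).trans_eq (measure_singleton t)) zero_le⟩
  set U := upm a b lm lp νip νim with hU
  set V := ump a b lm lp νip with hV
  obtain ⟨h1, h2⟩ := integrableOn_and_setIntegral_of_piecewise (ρ := ρm) (z := z)
    (w := wzpm a b lm lp νip νim z)
    (g₁ := fun t => (lp z * Gam a b lm lp νip * V z) * (V t - 1))
    (g₂ := fun t => (lp z * Gam a b lm lp νip * (V z - 1)) * V t)
    (continuousOn_const.mul (h.continuousOn_ump.sub continuousOn_const))
    (continuousOn_const.mul h.continuousOn_ump)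
    (fun t ht => by simp only [wzpm, max_eq_right ht.le, min_eq_left ht.le, hV]; ring)
    (fun t ht => by simp [wzpm, ht.le, hV]) le_rfl hp.1 hp.2
  refine ⟨h1, ?_⟩
  rw [h2, integral_const_mul, integral_const_mul, ← h.Gam_mul_upm_left hΓ]
  rcases le_or_gt z p with hpz | hpz
  · have hone : lm z * lp z * (Gam a b lm lp νip * (U z + V z - 1)) = 1 := by
      rw [h.Gam_mul_add_sub_one hΓ hz,
        mul_inv_cancel₀ (mul_pos (h.posm z hz) (h.posp z hz)).ne']
    rw [min_eq_right hpz, max_eq_right hz.1, h.setIntegral_ump_sub_one hΓ le_rfl hz.1 hz.2,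
      h.setIntegral_ump hΓ hz.1 hpz hp.2, wzpp, if_pos hpz]
    linear_combination hone
  · rw [min_eq_left hpz.le, max_eq_right hp.1, h.setIntegral_ump_sub_one hΓ le_rfl hp.1 hp.2,
      Ioc_self, Measure.restrict_empty, integral_zero_measure, wzpp, if_neg (not_le.2 hpz)]
    ring

lemma setIntegral_wzpp (h : IsControl a b lm lp ρm ρp νip νim σ) (hΓ : Gam a b lm lp νip ≠ 0)
    {z m : ℝ} (hz : z ∈ Icc a b) (hm : m ∈ Icc a b) :
    IntegrableOn (wzpp a b lm lp νip νim z) (Ioc m b) ρp ∧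
    ∫ t in Ioc m b, wzpp a b lm lp νip νim z t ∂ρp =
      wzpm a b lm lp νip νim z m * lp m -
        lp z * (ump a b lm lp νip z - 1) * (lm b)⁻¹ := by
  have := h.isFiniteMeasure
  have := h.nullSingletonClass
  have : IsFiniteMeasure ρp := isFiniteMeasure_of_le σ h.lep
  have : NullSingletonClass ρp :=
    ⟨fun t => le_antisymm ((h.lep {t}).trans_eq (measure_singleton t)) zero_le⟩
  set U := upm a b lm lp νip νim with hU
  set V := ump a b lm lp νip with hV
  obtain ⟨h1, h2⟩ := integrableOn_and_setIntegral_of_piecewise (ρ := ρp) (z := z)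
    (w := wzpp a b lm lp νip νim z)
    (g₁ := fun t => (lp z * Gam a b lm lp νip * V z) * U t)
    (g₂ := fun t => (lp z * Gam a b lm lp νip * (V z - 1)) * (U t - 1))
    (continuousOn_const.mul h.continuousOn_upm)
    (continuousOn_const.mul (h.continuousOn_upm.sub continuousOn_const))
    (fun t ht => by simp [wzpp, not_le.2 ht, hU, hV])
    (fun t ht => by simp [wzpp, ht.le, hU, hV]) hm.1 hm.2 le_rfl
  refine ⟨h1, ?_⟩
  rw [h2, integral_const_mul, integral_const_mul, ← h.Gam_mul_ump_right hΓ, min_eq_right hz.2]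
  rcases le_total m z with hmz | hmz
  · rw [max_eq_right hmz, h.setIntegral_upm hΓ hm.1 hmz hz.2,
      h.setIntegral_upm_sub_one hΓ hz.1 hz.2 le_rfl, wzpm, min_eq_left hmz, max_eq_right hmz]
    ring
  · rw [max_eq_left hmz, Ioc_self, Measure.restrict_empty, integral_zero_measure,
      h.setIntegral_upm_sub_one hΓ hm.1 hm.2 le_rfl, wzpm, min_eq_right hmz, max_eq_left hmz]
    ring

end IsControl

/-- formulas for the special weight functions: under (A3) and (A6),
with `(fm, fp)` the unique solution of Luckock's equation, the linear functional
associated with `(w^{z,−}₋, w^{z,−}₊)` has generator `1_{M₋(X) ≤ z} − fm z`, and the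
linear functional associated with `(w^{z,+}₋, w^{z,+}₊)` has generator
`1_{M₊(X) ≥ z} − fp z`.  Here `νip, νim` are the Lebesgue-Stieltjes measures of
`1/λ₊, 1/λ₋` on `[a,b]` and `μm, μp` are the arrival measures. -/
theorem stmt10 (a b : ℝ) (hab : a < b) (lm lp : ℝ → ℝ)
    (hA3 : A3 a b lm lp) (hA6 : A6 a b lm lp)
    (fm fp : ℝ → ℝ) (hsol : LuckockSol a b lm lp fm fp)
    (μm μp : MeasureTheory.Measure ℝ)
    (hμm : IsMuMinus a b lm μm) (hμp : IsMuPlus a b lp μp)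
    (νip νim : MeasureTheory.SignedMeasure ℝ)
    (hνip : IsLS a b (fun x => (lp x)⁻¹) νip)
    (hνim : IsLS a b (fun x => (lm x)⁻¹) νim)
    (z : ℝ) (hz : z ∈ Set.Icc a b) :
    (∀ X : OrderBook, IsConfig a b X →
      genOp a b μm μp (linF (wzmm a b lm lp νip νim z) (wzmp a b lm lp νip νim z)) X =
        (if Mminus a X ≤ z then (1 : ℝ) else 0) - fm z) ∧
    (∀ X : OrderBook, IsConfig a b X →
      genOp a b μm μp (linF (wzpm a b lm lp νip νim z) (wzpp a b lm lp νip νim z)) X =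
        (if z ≤ Mplus b X then (1 : ℝ) else 0) - fp z) := by
  obtain ⟨σ, νlm, νlp, νfm, νfp, h, hlm, hlp, hfm, hfp, hσ⟩ :=
    exists_isControl hab hA3 hA6 hsol hμm hμp hνip hνim
  obtain ⟨hΓ, hf⟩ := h.luckockSol_eq hsol hlm hlp hfm hfp hσ
  obtain ⟨hcm, hcp, -, -, hm0, hp0⟩ := hA3
  have ha := left_mem_Icc.2 hab.le
  have hb := right_mem_Icc.2 hab.le
  have hint : ∀ (w : ℝ → ℝ) (μ : Measure ℝ), IntegrableOn w (Ioc a b) (μ.restrict (Ioo a b)) →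
      Integrable w (μ.restrict (Ioo a b)) := by
    intro w μ hw
    rwa [IntegrableOn, Measure.restrict_restrict measurableSet_Ioc,
      inter_eq_self_of_subset_right Ioo_subset_Ioc_self] at hw
  refine ⟨fun X hX => ?_, fun X hX => ?_⟩
  · have hp := Ioc_subset_Icc_self (hX.Mplus_mem_Ioc hab)
    have hm := Ico_subset_Icc_self (hX.Mminus_mem_Ico hab)
    rw [genOp,
      hX.integral_Lminus hab hcm hm0 hμm (hint _ _ (h.setIntegral_wzmm hΓ hz hb).1)
        (by rw [wzmp, max_eq_left hz.2, h.upm_right hΓ]; ring),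
      hX.integral_Lplus hab hcp hp0 hμp (hint _ _ (h.setIntegral_wzmp hΓ hz ha).1)
        (by rw [wzmm, if_pos hz.1, h.ump_left hΓ]; ring),
      (h.setIntegral_wzmm hΓ hz hp).2, (h.setIntegral_wzmp hΓ hz hm).2, (hf z hz).1]
    ring
  · have hp := Ioc_subset_Icc_self (hX.Mplus_mem_Ioc hab)
    have hm := Ico_subset_Icc_self (hX.Mminus_mem_Ico hab)
    rw [genOp,
      hX.integral_Lminus hab hcm hm0 hμm (hint _ _ (h.setIntegral_wzpm hΓ hz hb).1)
        (by rw [wzpp, if_pos hz.2, h.upm_right hΓ]; ring),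
      hX.integral_Lplus hab hcp hp0 hμp (hint _ _ (h.setIntegral_wzpp hΓ hz ha).1)
        (by rw [wzpm, min_eq_left hz.1, h.ump_left hΓ]; ring),
      (h.setIntegral_wzpm hΓ hz hp).2, (h.setIntegral_wzpp hΓ hz hm).2, (hf z hz).2]
    ring
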